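/- arXiv:2007.06169 — 12 statements merged into one kernel-verified Lean document; each statement's English description precedes it below -/
import Mathlib

section
/- Let (X, 𝒜, μ) be a σ-finite measure space and let p and p₀ be probability densities with respect to μ such that μ({x : p(x) = 0 and p₀(x) > 0}) = 0 and ∫_{{p>0}} (p₀²/p) dμ < ∞. Let P₀ be the measure with density p₀, let h(p,p₀)² := ∫ (√p − √p₀)² dμ, and define the Bernstein 'norm' ‖f‖²_{P₀,B} := 2∫ (e^{|f|} − 1 − |f|) p₀ dμ. For an integrable function g and a measurable set A, write P₀(g | A) := (∫_A g dP₀)/P₀(A) if P₀(A) > 0 and P₀(g | A) := 0 otherwise. Then for every c ≥ 1, ‖(1/2)·log(p/p₀)‖²_{P₀,B} ≤ h(p,p₀)² · [2 + c · P₀( p₀/p | p₀/p ≥ (1 + 1/(2c))² )]. In particular, taking c = 2, ‖(1/2)·log(p/p₀)‖²_{P₀,B} ≤ 2·h(p,p₀)² · [1 + P₀( p₀/p | p₀/p ≥ 25/16 )]. -/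
open MeasureTheory
open scoped ENNReal

lemma aux_K {t : ℝ} (h1 : 1 ≤ t) (h2 : t ≤ 3 / 2) : t - 1 - Real.log t ≤ (1 - 1 / t) ^ 2 := by
  have h := Real.le_log_one_add_of_nonneg (x := t - 1) (by linarith)
  rw [show 1 + (t - 1) = t by ring] at h
  have key : t - 1 - (1 - 1 / t) ^ 2 ≤ 2 * (t - 1) / (t - 1 + 2) := by
    have ht : 0 < t := by linarith
    have ht2 : 0 < t - 1 + 2 := by linarith
    have e : 2 * (t - 1) / (t - 1 + 2) - (t - 1 - (1 - 1 / t) ^ 2)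
        = (t - 1) ^ 2 * (1 + t - t ^ 2) / (t ^ 2 * (t - 1 + 2)) := by
      field_simp
      ring
    have : 0 ≤ (t - 1) ^ 2 * (1 + t - t ^ 2) / (t ^ 2 * (t - 1 + 2)) := by
      have : 0 ≤ 1 + t - t ^ 2 := by nlinarith
      positivity
    linarith
  linarith

lemma aux_R {r : ℝ} (h1 : 1 ≤ r) : r - 1 - Real.log r ≤ (r - 1) ^ 2 := by
  have h := Real.le_log_one_add_of_nonneg (x := r - 1) (by linarith)
  rw [show 1 + (r - 1) = r by ring] at h
  have key : r - 1 - (r - 1) ^ 2 ≤ 2 * (r - 1) / (r - 1 + 2) := by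
    rw [le_div_iff₀ (by linarith)]
    nlinarith [mul_nonneg (sub_nonneg.2 h1) (sq_nonneg (r - 1)), sq_nonneg (r - 1)]
  linarith

/-- the log-ratio rewritten via square roots -/
lemma aux_log {p q : ℝ} (hp : 0 < p) (hq : 0 < q) :
    (1 / 2) * Real.log (p / q) = Real.log (√p / √q) := by
  rw [← Real.sqrt_div hp.le, Real.log_sqrt (by positivity)]
  ring

lemma aux_abs {v w : ℝ} (hv : 0 < v) (hw : 0 < w) (h : v ≤ w) :
    |Real.log (v / w)| = Real.log (w / v) := by
  rw [abs_of_nonpos (Real.log_nonpos (by positivity) ((div_le_one hw).2 h)), ← Real.log_inv, inv_div]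

lemma aux_A {v w : ℝ} (hv : 0 < v) (hw : 0 < w) (h : w ≤ 3 / 2 * v) :
    2 * ((Real.exp |Real.log (v / w)| - 1 - |Real.log (v / w)|) * w ^ 2) ≤ 2 * (v - w) ^ 2 := by
  have hw2 : 0 ≤ w ^ 2 := by positivity
  rcases le_total v w with hvw | hvw
  · rw [aux_abs hv hw hvw, Real.exp_log (by positivity)]
    have := aux_K (t := w / v) ((one_le_div hv).2 hvw) ((div_le_iff₀ hv).2 h)
    have h3 := mul_le_mul_of_nonneg_right this hw2
    have : (1 - 1 / (w / v)) ^ 2 * w ^ 2 = (v - w) ^ 2 := by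
      field_simp
      ring
    linarith
  · have h1 : 1 ≤ v / w := (one_le_div hw).2 hvw
    rw [abs_of_nonneg (Real.log_nonneg h1), Real.exp_log (by positivity)]
    have h3 := mul_le_mul_of_nonneg_right (aux_R h1) hw2
    have : (v / w - 1) ^ 2 * w ^ 2 = (v - w) ^ 2 := by
      field_simp
    linarith

lemma aux_B {v w c s : ℝ} (hv : 0 < v) (hw : 0 < w) (hc : 1 ≤ c) (hs : 0 < s)
    (h : (1 + 1 / (2 * c)) * v ≤ w) :
    2 * ((Real.exp |Real.log (v / w)| - 1 - |Real.log (v / w)|) * w ^ 2) + 1 / c * w ^ 2 ≤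
      s * (v - w) ^ 2 + 1 / s * (w ^ 2 / v ^ 2 * w ^ 2) + 2 * (v - w) ^ 2 := by
  have hw2 : 0 ≤ w ^ 2 := by positivity
  have hc0 : 0 < c := by linarith
  have hd : 0 < 1 / (2 * c) := by positivity
  have hd2 : 1 / (2 * c) ≤ 1 / 2 := by
    apply one_div_le_one_div_of_le <;> linarith
  have hb0 : 0 < 1 + 1 / (2 * c) := by positivity
  have hvw : v ≤ w := by nlinarith
  rw [aux_abs hv hw hvw, Real.exp_log (by positivity)]
  have hK := aux_K (t := 1 + 1 / (2 * c)) (by linarith) (by linarith)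
  have hbt : 1 + 1 / (2 * c) ≤ w / v := (le_div_iff₀ hv).2 h
  have hlog : Real.log (1 + 1 / (2 * c)) ≤ Real.log (w / v) := Real.log_le_log hb0 hbt
  have hu : 1 - 1 / (1 + 1 / (2 * c)) ≤ 1 - v / w := by
    have := one_div_le_one_div_of_le hb0 hbt
    rw [one_div_div] at this
    linarith
  have hu0 : 0 ≤ 1 - 1 / (1 + 1 / (2 * c)) := by
    have : 1 / (1 + 1 / (2 * c)) ≤ 1 := by
      rw [div_le_one hb0]; linarith
    linarith
  have hu2 := pow_le_pow_left₀ hu0 hu 2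
  have hcc : 1 / c = 2 * (1 / (2 * c)) := by field_simp
  have h1 : 2 * (w / v - 1 - Real.log (w / v)) + 1 / c ≤ 2 * (w / v - 1) + 2 * (1 - v / w) ^ 2 := by
    linarith
  have h2 := mul_le_mul_of_nonneg_right h1 hw2
  have e1 : (1 - v / w) ^ 2 * w ^ 2 = (v - w) ^ 2 := by
    field_simp
    ring
  have e2 : 2 * (w / v - 1) * w ^ 2 ≤ s * (v - w) ^ 2 + 1 / s * (w ^ 2 / v ^ 2 * w ^ 2) := by
    have : s * (v - w) ^ 2 + 1 / s * (w ^ 2 / v ^ 2 * w ^ 2) - 2 * (w / v - 1) * w ^ 2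
       = 1 / s * (s * (w - v) - w ^ 2 / v) ^ 2 := by
      field_simp
      ring
    have : 0 ≤ 1 / s * (s * (w - v) - w ^ 2 / v) ^ 2 := by positivity
    linarith
  nlinarith

lemma main_c {X : Type*} [MeasurableSpace X] (μ : Measure X)
    (p p₀ : X → ℝ) (hpm : Measurable p) (hp₀m : Measurable p₀)
    (hp0 : ∀ x, 0 ≤ p x) (hp₀0 : ∀ x, 0 ≤ p₀ x)
    (hp₀1 : ∫⁻ x, ENNReal.ofReal (p₀ x) ∂μ = 1)
    (hnull : μ {x | p x = 0 ∧ 0 < p₀ x} = 0)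
    (hfin : ∫⁻ x in {x | 0 < p x}, ENNReal.ofReal (p₀ x ^ 2 / p x) ∂μ < ⊤) (c : ℝ) (hc : 1 ≤ c) :
      2 * ∫⁻ x, ENNReal.ofReal
          ((Real.exp |(1 / 2) * Real.log (p x / p₀ x)| - 1 -
              |(1 / 2) * Real.log (p x / p₀ x)|) * p₀ x) ∂μ ≤
        (∫⁻ x, ENNReal.ofReal ((Real.sqrt (p x) - Real.sqrt (p₀ x)) ^ 2) ∂μ) *
          (ENNReal.ofReal 2 + ENNReal.ofReal c *
            ((∫⁻ x in {x | (1 + 1 / (2 * c)) ^ 2 ≤ p₀ x / p x},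
                ENNReal.ofReal (p₀ x / p x * p₀ x) ∂μ) /
              (∫⁻ x in {x | (1 + 1 / (2 * c)) ^ 2 ≤ p₀ x / p x},
                ENNReal.ofReal (p₀ x) ∂μ))) := by
  have hc0 : 0 < c := by linarith
  have hd : 0 < 1 / (2 * c) := by positivity
  have hd2 : 1 / (2 * c) ≤ 1 / 2 := by
    apply one_div_le_one_div_of_le <;> linarith
  set b : ℝ := 1 + 1 / (2 * c) with hb
  have hb1 : 1 < b := by linarith
  have hb2 : 1 < b ^ 2 := by nlinarith
  set A : Set X := {x | b ^ 2 ≤ p₀ x / p x} with hA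
  have hAm : MeasurableSet A := measurableSet_le measurable_const (hp₀m.div hpm)
  have hApos : ∀ x ∈ A, 0 < p x ∧ 0 < p₀ x := by
    intro x hx
    have hx : b ^ 2 ≤ p₀ x / p x := hx
    have h0 : 0 < p₀ x / p x := by linarith
    constructor
    · rcases (hp0 x).lt_or_eq with h | h
      · exact h
      · rw [← h] at h0; simp at h0
    · rcases (hp₀0 x).lt_or_eq with h | h
      · exact h
      · rw [← h] at h0; simp at h0
  set F : X → ℝ := fun x => (Real.exp |(1 / 2) * Real.log (p x / p₀ x)| - 1 -
              |(1 / 2) * Real.log (p x / p₀ x)|) * p₀ x with hF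
  have hFm : Measurable F := by fun_prop
  have hF0 : ∀ x, 0 ≤ F x := fun x =>
    mul_nonneg (by linarith [Real.add_one_le_exp |(1 / 2) * Real.log (p x / p₀ x)|]) (hp₀0 x)
  set G : X → ℝ := fun x => (Real.sqrt (p x) - Real.sqrt (p₀ x)) ^ 2 with hG
  have hGm : Measurable G := by fun_prop
  have hG0 : ∀ x, 0 ≤ G x := fun x => sq_nonneg _
  set N := ∫⁻ x in A, ENNReal.ofReal (p₀ x / p x * p₀ x) ∂μ with hN
  set a := ∫⁻ x in A, ENNReal.ofReal (p₀ x) ∂μ with ha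
  -- off A
  have hoff : 2 * ∫⁻ x in Aᶜ, ENNReal.ofReal (F x) ∂μ ≤
      ENNReal.ofReal 2 * ∫⁻ x in Aᶜ, ENNReal.ofReal (G x) ∂μ := by
    rw [← lintegral_const_mul _ hFm.ennreal_ofReal, ← lintegral_const_mul _ hGm.ennreal_ofReal]
    apply lintegral_mono_ae
    have hae : ∀ᵐ x ∂μ, ¬ (p x = 0 ∧ 0 < p₀ x) := by
      rw [ae_iff]; simpa using hnull
    filter_upwards [ae_restrict_of_ae hae, ae_restrict_mem hAm.compl] with x hx hxA
    rw [show (2 : ℝ≥0∞) = ENNReal.ofReal 2 by simp, ← ENNReal.ofReal_mul (by norm_num),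
      ← ENNReal.ofReal_mul (by norm_num)]
    apply ENNReal.ofReal_le_ofReal
    rcases (hp₀0 x).eq_or_lt with h0 | h0
    · have : F x = 0 := by simp [hF, ← h0]
      rw [this]; linarith [hG0 x]
    have hpx : 0 < p x := by
      rcases (hp0 x).eq_or_lt with h | h
      · exact absurd ⟨h.symm, h0⟩ hx
      · exact h
    have hlt : p₀ x / p x < b ^ 2 := not_le.1 hxA
    rw [div_lt_iff₀ hpx] at hlt
    have hv := Real.sqrt_pos.2 hpx
    have hw := Real.sqrt_pos.2 h0
    have hle : √(p₀ x) ≤ 3 / 2 * √(p x) := by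
      apply Real.sqrt_le_iff.2
      refine ⟨by positivity, ?_⟩
      rw [mul_pow, Real.sq_sqrt hpx.le]
      have : b ^ 2 ≤ (3 / 2) ^ 2 := pow_le_pow_left₀ (by linarith) (by linarith) 2
      nlinarith
    have := aux_A hv hw hle
    rw [Real.sq_sqrt h0.le] at this
    simp only [hF, hG]
    rw [aux_log hpx h0]
    exact this
  -- on A
  have hon : 2 * ∫⁻ x in A, ENNReal.ofReal (F x) ∂μ ≤
      (∫⁻ x in A, ENNReal.ofReal (G x) ∂μ) * (ENNReal.ofReal 2 + ENNReal.ofReal c * (N / a)) := by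
    by_cases ha0 : a = 0
    · have hμA : μ A = 0 := by
        by_contra hne
        have hpos : 0 < a := by
          rw [ha, setLIntegral_pos_iff hp₀m.ennreal_ofReal]
          refine lt_of_lt_of_le (pos_iff_ne_zero.2 hne) (measure_mono ?_)
          intro x hx
          refine ⟨?_, hx⟩
          simp [Function.mem_support, (hApos x hx).2]
        exact hpos.ne' ha0
      rw [setLIntegral_measure_zero _ _ hμA]
      simp
    have hatop : a ≠ ⊤ := by
      have : a ≤ 1 := by rw [← hp₀1]; exact setLIntegral_le_lintegral _ _
      exact ne_top_of_le_ne_top ENNReal.one_ne_top this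
    have haN : a ≤ N := by
      apply setLIntegral_mono' hAm
      intro x hx
      apply ENNReal.ofReal_le_ofReal
      have hx' : b ^ 2 ≤ p₀ x / p x := hx
      nlinarith [hp₀0 x]
    have hN0 : N ≠ 0 := fun h => ha0 (le_antisymm (h ▸ haN) zero_le)
    have hNtop : N ≠ ⊤ := by
      refine ne_top_of_le_ne_top hfin.ne ?_
      calc N ≤ ∫⁻ x in A, ENNReal.ofReal (p₀ x ^ 2 / p x) ∂μ := by
            apply setLIntegral_mono' hAm
            intro x hx
            apply ENNReal.ofReal_le_ofReal
            apply le_of_eq; ring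
        _ ≤ _ := lintegral_mono_set (fun x hx => (hApos x hx).1)
    have har : 0 < a.toReal := ENNReal.toReal_pos ha0 hatop
    have hNr : 0 < N.toReal := ENNReal.toReal_pos hN0 hNtop
    set s : ℝ := c * (N.toReal / a.toReal) with hs
    have hs0 : 0 < s := by positivity
    have hsE : ENNReal.ofReal s = ENNReal.ofReal c * (N / a) := by
      rw [hs, ENNReal.ofReal_mul hc0.le, ENNReal.ofReal_div_of_pos har, ENNReal.ofReal_toReal hNtop,
        ENNReal.ofReal_toReal hatop]
    have hsN : ENNReal.ofReal (1 / s) * N = ENNReal.ofReal (1 / c) * a := by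
      rw [← ENNReal.ofReal_toReal hNtop, ← ENNReal.ofReal_toReal hatop,
        ← ENNReal.ofReal_mul (by positivity), ← ENNReal.ofReal_mul (by positivity), hs]
      congr 1
      field_simp
    have hmain : 2 * (∫⁻ x in A, ENNReal.ofReal (F x) ∂μ) + ENNReal.ofReal (1 / c) * a ≤
        ENNReal.ofReal s * (∫⁻ x in A, ENNReal.ofReal (G x) ∂μ) + ENNReal.ofReal (1 / s) * N
        + ENNReal.ofReal 2 * (∫⁻ x in A, ENNReal.ofReal (G x) ∂μ) := by
      have hm : Measurable fun x => p₀ x / p x * p₀ x := by fun_prop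
      rw [hN, ha, ← lintegral_const_mul _ hFm.ennreal_ofReal,
        ← lintegral_const_mul _ hGm.ennreal_ofReal, ← lintegral_const_mul _ hGm.ennreal_ofReal,
        ← lintegral_const_mul _ hp₀m.ennreal_ofReal, ← lintegral_const_mul _ hm.ennreal_ofReal,
        ← lintegral_add_right _ (hp₀m.ennreal_ofReal.const_mul _),
        ← lintegral_add_right _ (hm.ennreal_ofReal.const_mul _),
        ← lintegral_add_right _ (hGm.ennreal_ofReal.const_mul _)]
      apply setLIntegral_mono' hAm
      intro x hx
      obtain ⟨hpx, h0⟩ := hApos x hx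
      have hv := Real.sqrt_pos.2 hpx
      have hw := Real.sqrt_pos.2 h0
      have hx' : b ^ 2 ≤ p₀ x / p x := hx
      rw [le_div_iff₀ hpx] at hx'
      have hle : b * √(p x) ≤ √(p₀ x) := by
        apply Real.le_sqrt_of_sq_le
        rw [mul_pow, Real.sq_sqrt hpx.le]
        exact hx'
      have key := aux_B hv hw hc hs0 hle
      rw [Real.sq_sqrt h0.le, Real.sq_sqrt hpx.le, ← aux_log hpx h0] at key
      have hq : 0 ≤ p₀ x / p x * p₀ x := by positivity
      have hFx := hF0 x
      have hGx := hG0 x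
      rw [show (2 : ℝ≥0∞) = ENNReal.ofReal 2 by simp, ← ENNReal.ofReal_mul (by norm_num),
        ← ENNReal.ofReal_mul (by positivity), ← ENNReal.ofReal_mul (by positivity),
        ← ENNReal.ofReal_mul (by positivity), ← ENNReal.ofReal_mul (by positivity),
        ← ENNReal.ofReal_add (by positivity) (by positivity),
        ← ENNReal.ofReal_add (by positivity) (by positivity),
        ← ENNReal.ofReal_add (by positivity) (by positivity)]
      exact ENNReal.ofReal_le_ofReal key
    rw [hsN, hsE] at hmain
    rw [add_right_comm] at hmain
    have hfin' : ENNReal.ofReal (1 / c) * a ≠ ⊤ := ENNReal.mul_ne_top ENNReal.ofReal_ne_top hatop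
    have := (ENNReal.add_le_add_iff_right hfin').1 hmain
    refine this.trans (le_of_eq ?_)
    ring
  rw [← lintegral_add_compl (fun x => ENNReal.ofReal (F x)) hAm,
    ← lintegral_add_compl (fun x => ENNReal.ofReal (G x)) hAm, mul_add, add_mul]
  refine add_le_add hon (hoff.trans ?_)
  rw [mul_comm]
  gcongr
  exact le_self_add

/-- Bound of the Bernstein 'norm' of the log likelihood ratio by the Hellinger distance:
with `f = (1/2)log(p/p₀)`, for every `c ≥ 1`,
`‖f‖²_{P₀,B} ≤ h(p,p₀)²·[2 + c·P₀(p₀/p | p₀/p ≥ (1+1/(2c))²)]`; in particular with `c = 2`,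
`‖f‖²_{P₀,B} ≤ 2·h(p,p₀)²·[1 + P₀(p₀/p | p₀/p ≥ 25/16)]`.
The conditional expectation `P₀(g | A) = (∫_A g dP₀)/P₀(A)` (with value `0` when
`P₀(A) = 0`) is encoded by the `ℝ≥0∞` quotient, for which `0/0 = 0`. -/
theorem stmt3 {X : Type*} [MeasurableSpace X] (μ : Measure X) [SigmaFinite μ]
    (p p₀ : X → ℝ) (hpm : Measurable p) (hp₀m : Measurable p₀)
    (hp0 : ∀ x, 0 ≤ p x) (hp₀0 : ∀ x, 0 ≤ p₀ x)
    (hp1 : ∫⁻ x, ENNReal.ofReal (p x) ∂μ = 1)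
    (hp₀1 : ∫⁻ x, ENNReal.ofReal (p₀ x) ∂μ = 1)
    (hnull : μ {x | p x = 0 ∧ 0 < p₀ x} = 0)
    (hfin : ∫⁻ x in {x | 0 < p x}, ENNReal.ofReal (p₀ x ^ 2 / p x) ∂μ < ⊤) :
    (∀ c : ℝ, 1 ≤ c →
      2 * ∫⁻ x, ENNReal.ofReal
          ((Real.exp |(1 / 2) * Real.log (p x / p₀ x)| - 1 -
              |(1 / 2) * Real.log (p x / p₀ x)|) * p₀ x) ∂μ ≤
        (∫⁻ x, ENNReal.ofReal ((Real.sqrt (p x) - Real.sqrt (p₀ x)) ^ 2) ∂μ) *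
          (ENNReal.ofReal 2 + ENNReal.ofReal c *
            ((∫⁻ x in {x | (1 + 1 / (2 * c)) ^ 2 ≤ p₀ x / p x},
                ENNReal.ofReal (p₀ x / p x * p₀ x) ∂μ) /
              (∫⁻ x in {x | (1 + 1 / (2 * c)) ^ 2 ≤ p₀ x / p x},
                ENNReal.ofReal (p₀ x) ∂μ)))) ∧
    2 * ∫⁻ x, ENNReal.ofReal
        ((Real.exp |(1 / 2) * Real.log (p x / p₀ x)| - 1 -
            |(1 / 2) * Real.log (p x / p₀ x)|) * p₀ x) ∂μ ≤
      2 * (∫⁻ x, ENNReal.ofReal ((Real.sqrt (p x) - Real.sqrt (p₀ x)) ^ 2) ∂μ) *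
        (1 + (∫⁻ x in {x | (25 : ℝ) / 16 ≤ p₀ x / p x},
                ENNReal.ofReal (p₀ x / p x * p₀ x) ∂μ) /
             (∫⁻ x in {x | (25 : ℝ) / 16 ≤ p₀ x / p x},
                ENNReal.ofReal (p₀ x) ∂μ)) := by
  refine ⟨fun c hc => main_c μ p p₀ hpm hp₀m hp0 hp₀0 hp₀1 hnull hfin c hc, ?_⟩
  have h := main_c μ p p₀ hpm hp₀m hp0 hp₀0 hp₀1 hnull hfin 2 (by norm_num)
  rw [show ((1 : ℝ) + 1 / (2 * 2)) ^ 2 = 25 / 16 by norm_num,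
    show ENNReal.ofReal 2 = 2 by simp] at h
  refine h.trans (le_of_eq ?_)
  ring
end

section
/- Let (X, 𝒜, μ) be a σ-finite measure space, let p₀ and p_θ be probability densities with respect to μ, let P₀ and P_θ be the measures with densities p₀ and p_θ, and let D_θ = p₀/(p₀+p_θ) (set to 1/2 where p₀+p_θ = 0) be the oracle discriminator. Let D : X → (0,1] be measurable with ∫ (D_θ/D) dP₀ < ∞, and set h_θ(D,D_θ)² := ∫ (√D − √D_θ)² (p₀+p_θ) dμ. Then ‖(1/2)·log(D/D_θ)‖²_{P₀,B} ≤ 2·h_θ(D,D_θ)² · [1 + P₀( D_θ/D | D_θ/D ≥ 25/16 )]. Symmetrically, if D : X → [0,1) is measurable with ∫ ((1−D_θ)/(1−D)) dP_θ < ∞, then ‖(1/2)·log((1−D)/(1−D_θ))‖²_{P_θ,B} ≤ 2·h_θ(1−D,1−D_θ)² · [1 + P_θ( (1−D_θ)/(1−D) | (1−D_θ)/(1−D) ≥ 25/16 )]. -/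
open MeasureTheory
open scoped ENNReal

/-- The oracle discriminator `D_θ = p₀/(p₀+p_θ)` (set to `1/2` where `p₀+p_θ = 0`). -/
noncomputable def oracleD {X : Type*} (p₀ pθ : X → ℝ) (x : X) : ℝ :=
  if 0 < p₀ x + pθ x then p₀ x / (p₀ x + pθ x) else 1 / 2

lemma bern_ge {x y : ℝ} (hx : 0 < x) (hy : 0 < y) :
    (1 / 2) * Real.log (x / y) = Real.log (Real.sqrt x / Real.sqrt y) := by
  rw [← Real.sqrt_div hx.le, Real.log_sqrt (by positivity)]
  ring

/-- Value of the Bernstein integrand when `D < q`. -/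
lemma bern_lt {x y : ℝ} (hx : 0 < x) (hxy : x ≤ y) :
    Real.exp |Real.log (x / y)| - 1 - |Real.log (x / y)| = y / x - 1 - Real.log (y / x) := by
  have hy : 0 < y := hx.trans_le hxy
  have h1 : Real.log (x / y) = - Real.log (y / x) := by
    rw [← Real.log_inv, inv_div]
  have h2 : 0 ≤ Real.log (y / x) := Real.log_nonneg (by rwa [le_div_iff₀ hx, one_mul])
  rw [h1, abs_neg, abs_of_nonneg h2, Real.exp_log (by positivity)]

lemma log_lower {x y : ℝ} (hx : 0 < x) (hxy : x ≤ y) :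
    2 * (y - x) / (y + x) ≤ Real.log (y / x) := by
  have h := Real.le_log_one_add_of_nonneg (x := y / x - 1)
    (by rw [sub_nonneg, le_div_iff₀ hx]; linarith)
  have e : 2 * (y / x - 1) / (y / x - 1 + 2) = 2 * (y - x) / (y + x) := by
    have h0 : 0 < y := hx.trans_le hxy
    have e1 : y / x - 1 + 2 = (y + x) / x := by field_simp; ring
    have e2 : 2 * (y / x - 1) = 2 * (y - x) / x := by field_simp
    rw [e1, e2, div_div_div_cancel_right₀ hx.ne']
  rw [e] at h
  simpa using h

lemma pt_one {D q : ℝ} (hD : 0 < D) (hq : 0 < q) (h : ¬ (25 : ℝ) / 16 ≤ q / D) :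
    (Real.exp |(1 / 2) * Real.log (D / q)| - 1 - |(1 / 2) * Real.log (D / q)|) * q
      ≤ (Real.sqrt D - Real.sqrt q) ^ 2 := by
  rw [bern_ge hD hq]
  have hx := Real.sqrt_pos.2 hD
  have hy := Real.sqrt_pos.2 hq
  have hxD := Real.sq_sqrt hD.le
  have hyq := Real.sq_sqrt hq.le
  set x := Real.sqrt D
  set y := Real.sqrt q
  rw [← hxD, ← hyq] at h
  rw [← hyq]
  rcases le_total x y with hxy | hxy
  · rw [bern_lt hx hxy]
    have hl := log_lower hx hxy
    have h5 : y < 5 / 4 * x := by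
      rw [not_le, div_lt_iff₀ (by positivity)] at h
      nlinarith
    have : y / x - 1 - 2 * (y - x) / (y + x) ≤ (x - y) ^ 2 / y ^ 2 := by
      have e : y / x - 1 - 2 * (y - x) / (y + x) = (x - y) ^ 2 / (x * (y + x)) := by
        field_simp
        ring
      rw [e]
      apply div_le_div_of_nonneg_left (by positivity) (by positivity)
      nlinarith
    calc _ ≤ (x - y) ^ 2 / y ^ 2 * y ^ 2 := by gcongr; linarith
      _ = _ := by field_simp
  · have h0 : 0 ≤ Real.log (x / y) := Real.log_nonneg (by rwa [le_div_iff₀ hy, one_mul])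
    rw [abs_of_nonneg h0, Real.exp_log (by positivity)]
    have hl := Real.one_sub_inv_le_log_of_pos (x := x / y) (by positivity)
    have : x / y - 1 - (1 - (x / y)⁻¹) ≤ (x - y) ^ 2 / y ^ 2 := by
      have e : x / y - 1 - (1 - (x / y)⁻¹) = (x - y) ^ 2 / (x * y) := by
        field_simp
      rw [e]
      apply div_le_div_of_nonneg_left (by positivity) (by positivity)
      nlinarith
    calc _ ≤ (x - y) ^ 2 / y ^ 2 * y ^ 2 := by gcongr; linarith
      _ = _ := by field_simp

lemma pt_two {D q b : ℝ} (hD : 0 < D) (hq : 0 < q) (hb : 0 < b) (h : (25 : ℝ) / 16 ≤ q / D) :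
    (Real.exp |(1 / 2) * Real.log (D / q)| - 1 - |(1 / 2) * Real.log (D / q)|) * q + q / 4
      ≤ (Real.sqrt D - Real.sqrt q) ^ 2 * (1 + b) + 1 / (4 * b) * (q / D * q) := by
  rw [bern_ge hD hq]
  have hx := Real.sqrt_pos.2 hD
  have hy := Real.sqrt_pos.2 hq
  have hxD := Real.sq_sqrt hD.le
  have hyq := Real.sq_sqrt hq.le
  set x := Real.sqrt D
  set y := Real.sqrt q
  rw [← hxD, ← hyq] at h
  rw [← hyq, ← hxD]
  have h5 : 5 / 4 * x ≤ y := by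
    rw [le_div_iff₀ (by positivity)] at h
    nlinarith
  have hxy : x ≤ y := by linarith
  rw [bern_lt hx hxy]
  have hl1 : (2 : ℝ) / 9 ≤ Real.log (y / x) := by
    refine le_trans ?_ (log_lower hx hxy)
    rw [div_le_div_iff₀ (by norm_num) (by positivity)]
    linarith
  have h25 : y ^ 2 / 25 ≤ (x - y) ^ 2 := by nlinarith
  have hcs : y / x * y ^ 2 - y ^ 2 ≤ (x - y) ^ 2 * b + 1 / (4 * b) * (y ^ 2 / x ^ 2 * y ^ 2) := by
    have : (x - y) ^ 2 * b + 1 / (4 * b) * (y ^ 2 / x ^ 2 * y ^ 2) - (y / x * y ^ 2 - y ^ 2)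
        = ((y - x) - y ^ 2 / (2 * b * x)) ^ 2 * b := by
      field_simp
      ring
    have : 0 ≤ ((y - x) - y ^ 2 / (2 * b * x)) ^ 2 * b := by positivity
    linarith
  have : (2 : ℝ) / 9 * y ^ 2 ≤ Real.log (y / x) * y ^ 2 := by gcongr
  nlinarith [sq_nonneg y]

lemma bern_nonneg (t : ℝ) : 0 ≤ Real.exp |t| - 1 - |t| := by
  have := Real.add_one_le_exp |t|
  linarith

theorem bern_main {X : Type*} [MeasurableSpace X] (μ : Measure X)
    (q D p w : X → ℝ) (hqm : Measurable q) (hDm : Measurable D) (hpm : Measurable p)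
    (hwm : Measurable w)
    (hq : ∀ x, 0 ≤ q x) (hD : ∀ x, 0 < D x) (hw : ∀ x, 0 ≤ w x) (hp : ∀ x, p x = q x * w x)
    (hp1 : ∫⁻ x, ENNReal.ofReal (p x) ∂μ = 1)
    (hfin : (∫⁻ x, ENNReal.ofReal (q x / D x * p x) ∂μ) < ⊤) :
    2 * ∫⁻ x, ENNReal.ofReal
          ((Real.exp |(1 / 2) * Real.log (D x / q x)| - 1 -
              |(1 / 2) * Real.log (D x / q x)|) * p x) ∂μ ≤
        2 * (∫⁻ x, ENNReal.ofReal
              ((Real.sqrt (D x) - Real.sqrt (q x)) ^ 2 * w x) ∂μ) *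
          (1 + (∫⁻ x in {x | (25 : ℝ) / 16 ≤ q x / D x},
                  ENNReal.ofReal (q x / D x * p x) ∂μ) /
               (∫⁻ x in {x | (25 : ℝ) / 16 ≤ q x / D x},
                  ENNReal.ofReal (p x) ∂μ)) := by
  have hp0 : ∀ x, 0 ≤ p x := fun x => by rw [hp]; exact mul_nonneg (hq x) (hw x)
  set A : Set X := {x | (25 : ℝ) / 16 ≤ q x / D x} with hA
  have hAm : MeasurableSet A := measurableSet_le measurable_const (hqm.div hDm)
  set f : X → ℝ := fun x => (Real.exp |(1 / 2) * Real.log (D x / q x)| - 1 -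
              |(1 / 2) * Real.log (D x / q x)|) with hf
  have hf0 : ∀ x, 0 ≤ f x := fun x => bern_nonneg _
  have hfm : Measurable f := by
    have h1 : Measurable fun x => |(1 / 2) * Real.log (D x / q x)| :=
      (((hDm.div hqm).log).const_mul _).abs
    exact (h1.exp.sub_const 1).sub h1
  have hfpm : Measurable fun x => ENNReal.ofReal (f x * p x) := (hfm.mul hpm).ennreal_ofReal
  have hBm : Measurable fun x => ENNReal.ofReal (q x / D x * p x) :=
    ((hqm.div hDm).mul hpm).ennreal_ofReal
  set g : X → ℝ := fun x => (Real.sqrt (D x) - Real.sqrt (q x)) ^ 2 * w x with hg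
  have hg0 : ∀ x, 0 ≤ g x := fun x => mul_nonneg (sq_nonneg _) (hw x)
  have hgm : Measurable g := ((hDm.sqrt.sub hqm.sqrt).pow_const 2).mul hwm
  change 2 * ∫⁻ x, ENNReal.ofReal (f x * p x) ∂μ ≤ 2 * (∫⁻ x, ENNReal.ofReal (g x) ∂μ) * _
  rw [mul_assoc]
  gcongr
  rw [← lintegral_add_compl (fun x => ENNReal.ofReal (f x * p x)) hAm,
    ← lintegral_add_compl (fun x => ENNReal.ofReal (g x)) hAm, add_mul]
  set P := ∫⁻ x in A, ENNReal.ofReal (p x) ∂μ with hP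
  set B := ∫⁻ x in A, ENNReal.ofReal (q x / D x * p x) ∂μ with hB
  refine add_le_add ?_ ?_
  · by_cases hP0 : P = 0
    · rw [hP, lintegral_eq_zero_iff hpm.ennreal_ofReal] at hP0
      have : ∫⁻ x in A, ENNReal.ofReal (f x * p x) ∂μ = 0 := by
        rw [lintegral_eq_zero_iff hfpm]
        filter_upwards [hP0] with x hx
        have : p x = 0 := le_antisymm (ENNReal.ofReal_eq_zero.1 hx) (hp0 x)
        simp [this]
      rw [this]
      exact zero_le
    · have hPt : P ≠ ⊤ := ne_top_of_le_ne_top (by rw [hp1]; simp) (setLIntegral_le_lintegral A _)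
      have hBt : B ≠ ⊤ := ne_top_of_le_ne_top hfin.ne (setLIntegral_le_lintegral A _)
      have hPB : P ≤ B := by
        refine setLIntegral_mono (((hqm.div hDm).mul hpm).ennreal_ofReal) ?_
        intro x hx
        apply ENNReal.ofReal_le_ofReal
        have h1 : (25 : ℝ) / 16 ≤ q x / D x := hx
        nlinarith [hp0 x]
      have hB0 : B ≠ 0 := fun h => hP0 (le_antisymm (h ▸ hPB) zero_le)
      set b := (B / P).toReal with hb
      have hbt : B / P ≠ ⊤ := ENNReal.div_ne_top hBt hP0
      have hb0 : 0 < b := ENNReal.toReal_pos (ENNReal.div_ne_zero.2 ⟨hB0, hPt⟩) hbt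
      have hbe : B / P = ENNReal.ofReal b := (ENNReal.ofReal_toReal hbt).symm
      have key : ∫⁻ x in A, ENNReal.ofReal (f x * p x) + ENNReal.ofReal (1 / 4) * ENNReal.ofReal (p x) ∂μ
          ≤ ∫⁻ x in A, ENNReal.ofReal (g x) * ENNReal.ofReal (1 + b)
            + ENNReal.ofReal (1 / (4 * b)) * ENNReal.ofReal (q x / D x * p x) ∂μ := by
        refine setLIntegral_mono ?_ ?_
        · exact (hgm.ennreal_ofReal.mul_const _).add
            ((((hqm.div hDm).mul hpm).ennreal_ofReal).const_mul _)
        intro x hx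
        have h1 : (25 : ℝ) / 16 ≤ q x / D x := hx
        have hqx : 0 < q x := by
          rcases (hq x).eq_or_lt with h | h
          · rw [← h] at h1; norm_num at h1
          · exact h
        have hqD : 0 ≤ q x / D x * p x := mul_nonneg (by linarith) (hp0 x)
        rw [← ENNReal.ofReal_mul (by norm_num), ← ENNReal.ofReal_mul (hg0 x),
          ← ENNReal.ofReal_mul (by positivity),
          ← ENNReal.ofReal_add (mul_nonneg (hf0 x) (hp0 x)) (mul_nonneg (by norm_num) (hp0 x)),
          ← ENNReal.ofReal_add (mul_nonneg (hg0 x) (by positivity))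
            (mul_nonneg (by positivity) hqD)]
        apply ENNReal.ofReal_le_ofReal
        have := mul_le_mul_of_nonneg_right (pt_two (hD x) hqx hb0 h1) (hw x)
        rw [hp]
        simp only [hf, hg]
        linarith
      rw [lintegral_add_left hfpm,
        lintegral_add_left (hgm.ennreal_ofReal.mul_const _),
        lintegral_const_mul _ hpm.ennreal_ofReal,
        lintegral_mul_const _ hgm.ennreal_ofReal,
        lintegral_const_mul _ hBm, ← hP, ← hB] at key
      have hBP : B = ENNReal.ofReal b * P := by
        rw [← hbe, ENNReal.div_mul_cancel hP0 hPt]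
      have e : ENNReal.ofReal (1 / (4 * b)) * B = ENNReal.ofReal (1 / 4) * P := by
        rw [hBP, ← mul_assoc, ← ENNReal.ofReal_mul (by positivity)]
        congr 2
        field_simp
      rw [e] at key
      rw [hbe, ← ENNReal.ofReal_one, ← ENNReal.ofReal_add (by norm_num) hb0.le]
      exact (ENNReal.add_le_add_iff_right (ENNReal.mul_ne_top ENNReal.ofReal_ne_top hPt)).1 key
  · calc _ ≤ ∫⁻ x in Aᶜ, ENNReal.ofReal (g x) ∂μ := by
          refine setLIntegral_mono hgm.ennreal_ofReal ?_
          intro x hx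
          apply ENNReal.ofReal_le_ofReal
          have h1 : ¬ (25 : ℝ) / 16 ≤ q x / D x := hx
          rcases (hq x).eq_or_lt with h | h
          · rw [hp, ← h]
            simpa using hg0 x
          · have := mul_le_mul_of_nonneg_right (pt_one (hD x) h h1) (hw x)
            rw [hp]
            simp only [hf, hg]
            linarith
      _ ≤ _ := le_mul_of_one_le_right zero_le le_self_add

/-- Bernstein-'norm' bounds for log discriminator ratios against the oracle:
for `D : X → (0,1]` with `∫ D_θ/D dP₀ < ∞`,
`‖(1/2)log(D/D_θ)‖²_{P₀,B} ≤ 2 h_θ(D,D_θ)² [1 + P₀(D_θ/D | D_θ/D ≥ 25/16)]`,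
and symmetrically for `D : X → [0,1)` with `∫ (1−D_θ)/(1−D) dP_θ < ∞`,
`‖(1/2)log((1−D)/(1−D_θ))‖²_{P_θ,B} ≤ 2 h_θ(1−D,1−D_θ)² [1 + P_θ((1−D_θ)/(1−D) | ... ≥ 25/16)]`,
where `h_θ(D₁,D₂)² = ∫ (√D₁−√D₂)²(p₀+p_θ) dμ` and conditional expectations are
encoded by `ℝ≥0∞` quotients (so that `P(A) = 0` gives the value `0`). -/
theorem stmt4 {X : Type*} [MeasurableSpace X] (μ : Measure X) [SigmaFinite μ]
    (p₀ pθ : X → ℝ) (hp₀m : Measurable p₀) (hpθm : Measurable pθ)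
    (hp₀0 : ∀ x, 0 ≤ p₀ x) (hpθ0 : ∀ x, 0 ≤ pθ x)
    (hp₀1 : ∫⁻ x, ENNReal.ofReal (p₀ x) ∂μ = 1)
    (hpθ1 : ∫⁻ x, ENNReal.ofReal (pθ x) ∂μ = 1) :
    (∀ D : X → ℝ, Measurable D → (∀ x, 0 < D x ∧ D x ≤ 1) →
      (∫⁻ x, ENNReal.ofReal (oracleD p₀ pθ x / D x * p₀ x) ∂μ) < ⊤ →
      2 * ∫⁻ x, ENNReal.ofReal
          ((Real.exp |(1 / 2) * Real.log (D x / oracleD p₀ pθ x)| - 1 -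
              |(1 / 2) * Real.log (D x / oracleD p₀ pθ x)|) * p₀ x) ∂μ ≤
        2 * (∫⁻ x, ENNReal.ofReal
              ((Real.sqrt (D x) - Real.sqrt (oracleD p₀ pθ x)) ^ 2 * (p₀ x + pθ x)) ∂μ) *
          (1 + (∫⁻ x in {x | (25 : ℝ) / 16 ≤ oracleD p₀ pθ x / D x},
                  ENNReal.ofReal (oracleD p₀ pθ x / D x * p₀ x) ∂μ) /
               (∫⁻ x in {x | (25 : ℝ) / 16 ≤ oracleD p₀ pθ x / D x},
                  ENNReal.ofReal (p₀ x) ∂μ))) ∧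
    (∀ D : X → ℝ, Measurable D → (∀ x, 0 ≤ D x ∧ D x < 1) →
      (∫⁻ x, ENNReal.ofReal ((1 - oracleD p₀ pθ x) / (1 - D x) * pθ x) ∂μ) < ⊤ →
      2 * ∫⁻ x, ENNReal.ofReal
          ((Real.exp |(1 / 2) * Real.log ((1 - D x) / (1 - oracleD p₀ pθ x))| - 1 -
              |(1 / 2) * Real.log ((1 - D x) / (1 - oracleD p₀ pθ x))|) * pθ x) ∂μ ≤
        2 * (∫⁻ x, ENNReal.ofReal
              ((Real.sqrt (1 - D x) - Real.sqrt (1 - oracleD p₀ pθ x)) ^ 2 * (p₀ x + pθ x)) ∂μ) *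
          (1 + (∫⁻ x in {x | (25 : ℝ) / 16 ≤ (1 - oracleD p₀ pθ x) / (1 - D x)},
                  ENNReal.ofReal ((1 - oracleD p₀ pθ x) / (1 - D x) * pθ x) ∂μ) /
               (∫⁻ x in {x | (25 : ℝ) / 16 ≤ (1 - oracleD p₀ pθ x) / (1 - D x)},
                  ENNReal.ofReal (pθ x) ∂μ))) := by
  have hm : Measurable (oracleD p₀ pθ) :=
    Measurable.ite (measurableSet_lt measurable_const (hp₀m.add hpθm))
      (hp₀m.div (hp₀m.add hpθm)) measurable_const
  have e0 : ∀ x, 0 ≤ oracleD p₀ pθ x ∧ 0 ≤ 1 - oracleD p₀ pθ x ∧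
      p₀ x = oracleD p₀ pθ x * (p₀ x + pθ x) ∧ pθ x = (1 - oracleD p₀ pθ x) * (p₀ x + pθ x) := by
    intro x
    have h1 := hp₀0 x
    have h2 := hpθ0 x
    unfold oracleD
    split_ifs with h
    · have e : p₀ x / (p₀ x + pθ x) * (p₀ x + pθ x) = p₀ x := div_mul_cancel₀ _ h.ne'
      refine ⟨div_nonneg h1 h.le, ?_, e.symm, by rw [sub_mul, e]; ring⟩
      rw [sub_nonneg, div_le_one h]
      linarith
    · refine ⟨by norm_num, by norm_num, ?_, ?_⟩ <;> linarith
  refine ⟨fun D hDm hD hfin => ?_, fun D hDm hD hfin => ?_⟩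
  · exact bern_main μ (oracleD p₀ pθ) D p₀ (fun x => p₀ x + pθ x) hm hDm hp₀m (hp₀m.add hpθm)
      (fun x => (e0 x).1) (fun x => (hD x).1) (fun x => add_nonneg (hp₀0 x) (hpθ0 x))
      (fun x => (e0 x).2.2.1) hp₀1 hfin
  · exact bern_main μ (fun x => 1 - oracleD p₀ pθ x) (fun x => 1 - D x) pθ
      (fun x => p₀ x + pθ x) (hm.const_sub 1) (hDm.const_sub 1) hpθm (hp₀m.add hpθm)
      (fun x => (e0 x).2.1) (fun x => sub_pos.2 (hD x).2)
      (fun x => add_nonneg (hp₀0 x) (hpθ0 x)) (fun x => (e0 x).2.2.2) hpθ1 hfin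
end

section
/- Let (X, 𝒜, μ) be a σ-finite measure space and let p₀, p₁, p₂ be probability densities with respect to μ. On the set {p₀ > 0} the ratio r(x) := (p₀(x)+p₂(x))/(p₀(x)+p₁(x)) is a well-defined positive real number, and 2·∫_{{p₀>0}} ( e^{|log r|} − 1 − |log r| ) p₀ dμ ≤ 8·∫ (√p₁ − √p₂)² dμ. In the notation of the adversarial framework, with oracle discriminators D_{θ₁} = p₀/(p₀+p₁) and D_{θ₂} = p₀/(p₀+p₂), this says ‖log(D_{θ₁}/D_{θ₂})‖²_{P₀,B} ≤ 8·h(p₁,p₂)², where P₀ is the measure with density p₀. -/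
open MeasureTheory
open scoped ENNReal

lemma aux_log_s5 (t : ℝ) (ht : 1 ≤ t) : t ^ 2 - 1 - Real.log (t ^ 2) ≤ 3 * (t - 1) ^ 2 := by
  have h0 : 0 < t := by linarith
  have h1 : 1 - t⁻¹ ≤ Real.log t := Real.one_sub_inv_le_log_of_pos h0
  rw [Real.log_pow]
  push_cast
  have h2 : t * t⁻¹ = 1 := mul_inv_cancel₀ h0.ne'
  have h3 : 0 ≤ 1 - t⁻¹ := by
    have := inv_le_one_of_one_le₀ ht
    linarith
  have h4 : t ^ 2 - 3 + 2 * t⁻¹ = (t - 1) ^ 2 * (1 + 2 * t⁻¹) := by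
    field_simp
    ring
  nlinarith [mul_nonneg (sq_nonneg (t - 1)) h3]

lemma aux_sqrt (a b c : ℝ) (ha : 0 < a) (hb : 0 ≤ b) (hbc : b ≤ c) :
    √(a + c) - √(a + b) ≤ √c - √b := by
  have h1 := Real.sq_sqrt (show 0 ≤ a + c by linarith)
  have h2 := Real.sq_sqrt (show 0 ≤ a + b by linarith)
  have h3 := Real.sq_sqrt (show 0 ≤ c by linarith)
  have h4 := Real.sq_sqrt hb
  have h5 : √c ≤ √(a + c) := Real.sqrt_le_sqrt (by linarith)
  have h6 : √b ≤ √(a + b) := Real.sqrt_le_sqrt (by linarith)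
  have h7 : √b ≤ √c := Real.sqrt_le_sqrt hbc
  have h8 : 0 < √(a + b) := Real.sqrt_pos.2 (by linarith)
  have h9 := Real.sqrt_nonneg c
  by_contra! h
  nlinarith [mul_nonneg (sub_nonneg.2 h7) (by linarith : 0 ≤ √(a + c) + √(a + b) - √c - √b),
    mul_pos (sub_pos.2 h) (by linarith : 0 < √(a + c) + √(a + b))]

lemma aux_mono (a b c : ℝ) (ha : 0 < a) (hb : 0 ≤ b) (hbc : b ≤ c) :
    (Real.exp |Real.log ((a + c) / (a + b))| - 1 - |Real.log ((a + c) / (a + b))|) * a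
      ≤ 4 * (√c - √b) ^ 2 := by
  have hab : 0 < a + b := by linarith
  have hs : 1 ≤ (a + c) / (a + b) := by
    rw [one_le_div hab]
    linarith
  rw [abs_of_nonneg (Real.log_nonneg hs), Real.exp_log (by linarith)]
  have hv : 0 < √(a + b) := Real.sqrt_pos.2 hab
  have huv : √(a + b) ≤ √(a + c) := Real.sqrt_le_sqrt (by linarith)
  have ht : 1 ≤ √(a + c) / √(a + b) := by rwa [one_le_div hv]
  have hl := aux_log_s5 _ ht
  have e : (√(a + c) / √(a + b)) ^ 2 = (a + c) / (a + b) := by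
    rw [div_pow, Real.sq_sqrt (by linarith), Real.sq_sqrt hab.le]
  rw [e] at hl
  have h1 := aux_sqrt a b c ha hb hbc
  have h2 : (√(a + c) / √(a + b) - 1) ^ 2 * (a + b) = (√(a + c) - √(a + b)) ^ 2 := by
    nth_rewrite 2 [← Real.sq_sqrt hab.le]
    rw [← mul_pow, sub_mul, div_mul_cancel₀ _ hv.ne', one_mul]
  have h3 : (√(a + c) - √(a + b)) ^ 2 ≤ (√c - √b) ^ 2 :=
    pow_le_pow_left₀ (by linarith) h1 2
  have h4 := mul_le_mul_of_nonneg_right hl ha.le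
  have h5 := mul_nonneg (sq_nonneg (√(a + c) / √(a + b) - 1)) hb
  nlinarith [sq_nonneg (√c - √b)]

lemma aux_pt (a b c : ℝ) (ha : 0 < a) (hb : 0 ≤ b) (hc : 0 ≤ c) :
    (Real.exp |Real.log ((a + c) / (a + b))| - 1 - |Real.log ((a + c) / (a + b))|) * a
      ≤ 4 * (√b - √c) ^ 2 := by
  rcases le_total b c with h | h
  · have := aux_mono a b c ha hb h
    rwa [sub_sq_comm] at this
  · have := aux_mono a c b ha hc h
    rwa [← inv_div, Real.log_inv, abs_neg] at this

/-- Bernstein-'norm' bound for the log ratio of two oracle discriminators: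
with `r = (p₀+p₂)/(p₀+p₁)`, well defined and positive on `{p₀ > 0}`,
`2∫_{p₀>0} (e^{|log r|} − 1 − |log r|) p₀ dμ ≤ 8∫(√p₁ − √p₂)² dμ`, i.e.
`‖log(D_{θ₁}/D_{θ₂})‖²_{P₀,B} ≤ 8 h(p₁,p₂)²`. -/
theorem stmt5 {X : Type*} [MeasurableSpace X] (μ : Measure X) [SigmaFinite μ]
    (p₀ p₁ p₂ : X → ℝ)
    (hp₀m : Measurable p₀) (hp₁m : Measurable p₁) (hp₂m : Measurable p₂)
    (hp₀0 : ∀ x, 0 ≤ p₀ x) (hp₁0 : ∀ x, 0 ≤ p₁ x) (hp₂0 : ∀ x, 0 ≤ p₂ x)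
    (hp₀1 : ∫⁻ x, ENNReal.ofReal (p₀ x) ∂μ = 1)
    (hp₁1 : ∫⁻ x, ENNReal.ofReal (p₁ x) ∂μ = 1)
    (hp₂1 : ∫⁻ x, ENNReal.ofReal (p₂ x) ∂μ = 1) :
    (∀ x, 0 < p₀ x → 0 < (p₀ x + p₂ x) / (p₀ x + p₁ x)) ∧
    2 * ∫⁻ x in {x | 0 < p₀ x}, ENNReal.ofReal
        ((Real.exp |Real.log ((p₀ x + p₂ x) / (p₀ x + p₁ x))| - 1 -
            |Real.log ((p₀ x + p₂ x) / (p₀ x + p₁ x))|) * p₀ x) ∂μ ≤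
      8 * ∫⁻ x, ENNReal.ofReal ((Real.sqrt (p₁ x) - Real.sqrt (p₂ x)) ^ 2) ∂μ := by
  refine ⟨fun x hx => div_pos (by linarith [hp₂0 x]) (by linarith [hp₁0 x]), ?_⟩
  have hS : MeasurableSet {x | 0 < p₀ x} := measurableSet_lt measurable_const hp₀m
  have key : ∫⁻ x in {x | 0 < p₀ x}, ENNReal.ofReal
        ((Real.exp |Real.log ((p₀ x + p₂ x) / (p₀ x + p₁ x))| - 1 -
            |Real.log ((p₀ x + p₂ x) / (p₀ x + p₁ x))|) * p₀ x) ∂μ ≤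
      4 * ∫⁻ x, ENNReal.ofReal ((Real.sqrt (p₁ x) - Real.sqrt (p₂ x)) ^ 2) ∂μ := by
    rw [← lintegral_const_mul' _ _ (by norm_num)]
    refine le_trans (setLIntegral_mono' hS fun x hx => ?_) (setLIntegral_le_lintegral _ _)
    refine (ENNReal.ofReal_le_ofReal (aux_pt _ _ _ hx (hp₁0 x) (hp₂0 x))).trans ?_
    rw [ENNReal.ofReal_mul (by norm_num)]
    simp
  calc _ ≤ 2 * (4 * ∫⁻ x, ENNReal.ofReal ((Real.sqrt (p₁ x) - Real.sqrt (p₂ x)) ^ 2) ∂μ) := by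
        gcongr
    _ = _ := by
        rw [← mul_assoc]
        norm_num
end

section
/- Let (X, 𝒜, μ) be a σ-finite measure space, let p₀ and p_θ be probability densities with respect to μ, and let D_θ = p₀/(p₀+p_θ) (set to 1/2 where p₀+p_θ = 0) be the oracle discriminator. Then for every measurable D : X → [0,1], ∫ p₀ · log(D/D_θ) dμ ≤ − ∫ (√D − √D_θ)² (p₀+p_θ) dμ + ∫ (D − D_θ)(p₀+p_θ) dμ, where the left-hand integral is well defined in [−∞,∞) (its positive part is integrable, with the convention log 0 = −∞). Symmetrically, ∫ p_θ · log((1−D)/(1−D_θ)) dμ ≤ − ∫ (√(1−D) − √(1−D_θ))² (p₀+p_θ) dμ − ∫ (D − D_θ)(p₀+p_θ) dμ. -/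
open MeasureTheory
open scoped ENNReal

lemma key_pointwise (p s D E : ℝ) (hs : 0 ≤ s) (hp : p = E * s) (hD : 0 ≤ D) (hE : 0 ≤ E)
    (h : ¬ (D = 0 ∧ p ≠ 0)) :
    p * Real.log (D / E) ≤ -((Real.sqrt D - Real.sqrt E) ^ 2 * s) + (D - E) * s := by
  have h1 : -((Real.sqrt D - Real.sqrt E) ^ 2 * s) + (D - E) * s
      = 2 * (Real.sqrt D * Real.sqrt E * s) - 2 * (E * s) := by
    have e1 := Real.sq_sqrt hD
    have e2 := Real.sq_sqrt hE
    linear_combination (-s) * e1 - s * e2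
  rw [h1]
  by_cases hp0 : p = 0
  · rw [← hp, hp0]
    have : 0 ≤ Real.sqrt D * Real.sqrt E * s := by positivity
    linarith
  · have hD0 : D ≠ 0 := fun h0 => h ⟨h0, hp0⟩
    have hE0 : E ≠ 0 := fun h0 => hp0 (by rw [hp, h0, zero_mul])
    have hDp : 0 < D := lt_of_le_of_ne hD hD0.symm
    have hEp : 0 < E := lt_of_le_of_ne hE hE0.symm
    have hsE : 0 < Real.sqrt E := Real.sqrt_pos.2 hEp
    have hsD : 0 < Real.sqrt D := Real.sqrt_pos.2 hDp
    have hl : Real.log (D / E) ≤ 2 * (Real.sqrt D / Real.sqrt E - 1) := by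
      have := Real.log_le_sub_one_of_pos (div_pos hsD hsE)
      have h2 : D / E = (Real.sqrt D / Real.sqrt E) ^ 2 := by
        rw [div_pow, Real.sq_sqrt hD, Real.sq_sqrt hE]
      rw [h2, Real.log_pow]
      push_cast
      linarith
    have hpn : 0 ≤ p := by rw [hp]; positivity
    refine (mul_le_mul_of_nonneg_left hl hpn).trans (le_of_eq ?_)
    have h3 : E * (Real.sqrt D / Real.sqrt E) = Real.sqrt D * Real.sqrt E := by
      have e2 := Real.sq_sqrt hE
      field_simp
      rw [e2]
    rw [hp]
    linear_combination 2 * s * h3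

lemma key_integral {X : Type*} [MeasurableSpace X] (μ : Measure X)
    (p s D E : X → ℝ) (hpm : Measurable p) (hsi : Integrable s μ)
    (hDm : Measurable D) (hEm : Measurable E)
    (hs : ∀ x, 0 ≤ s x) (hp : ∀ x, p x = E x * s x)
    (hD : ∀ x, D x ∈ Set.Icc (0 : ℝ) 1) (hE : ∀ x, E x ∈ Set.Icc (0 : ℝ) 1) :
    (∫⁻ x, ENNReal.ofReal (p x * Real.log (D x / E x)) ∂μ) ≠ ⊤ ∧
      ((∫⁻ x, ENNReal.ofReal (p x * Real.log (D x / E x)) ∂μ : ℝ≥0∞) : EReal) -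
        ((∫⁻ x, (if D x = 0 ∧ p x ≠ 0 then (⊤ : ℝ≥0∞)
            else ENNReal.ofReal (p x * (-Real.log (D x / E x)))) ∂μ : ℝ≥0∞) : EReal) ≤
      ((- ∫ x, (Real.sqrt (D x) - Real.sqrt (E x)) ^ 2 * s x ∂μ
          + ∫ x, (D x - E x) * s x ∂μ : ℝ) : EReal) := by
  have hi1 : Integrable (fun x => (Real.sqrt (D x) - Real.sqrt (E x)) ^ 2 * s x) μ := by
    refine hsi.bdd_mul (c := 1) (by fun_prop) (Filter.Eventually.of_forall fun x => ?_)
    have a1 := Real.sqrt_nonneg (D x)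
    have a2 := Real.sqrt_nonneg (E x)
    have a3 := Real.sqrt_le_one.2 (hD x).2
    have a4 := Real.sqrt_le_one.2 (hE x).2
    rw [Real.norm_eq_abs, abs_of_nonneg (sq_nonneg _), sq_le_one_iff_abs_le_one, abs_le]
    constructor <;> linarith
  have hi2 : Integrable (fun x => (D x - E x) * s x) μ := by
    refine hsi.bdd_mul (c := 1) (by fun_prop) (Filter.Eventually.of_forall fun x => ?_)
    rw [Real.norm_eq_abs, abs_le]
    have := hD x
    have := hE x
    simp only [Set.mem_Icc] at *
    constructor <;> linarith
  set F : X → ℝ := fun x => -((Real.sqrt (D x) - Real.sqrt (E x)) ^ 2 * s x) + (D x - E x) * s x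
    with hF
  have hFi : Integrable F μ := hi1.neg.add hi2
  have hFint : ∫ x, F x ∂μ = - ∫ x, (Real.sqrt (D x) - Real.sqrt (E x)) ^ 2 * s x ∂μ
          + ∫ x, (D x - E x) * s x ∂μ := by
    rw [← integral_neg]
    exact integral_add hi1.neg hi2
  have hpt : ∀ x, ¬ (D x = 0 ∧ p x ≠ 0) → p x * Real.log (D x / E x) ≤ F x := fun x hx =>
    key_pointwise _ _ _ _ (hs x) (hp x) (hD x).1 (hE x).1 hx
  have hgm : Measurable (fun x => p x * Real.log (D x / E x)) := by fun_prop
  have hpos : (∫⁻ x, ENNReal.ofReal (p x * Real.log (D x / E x)) ∂μ) ≠ ⊤ := by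
    refine ne_top_of_le_ne_top hFi.lintegral_lt_top.ne (lintegral_mono fun x => ?_)
    by_cases hx : D x = 0 ∧ p x ≠ 0
    · simp [hx.1]
    · exact ENNReal.ofReal_le_ofReal (hpt x hx)
  refine ⟨hpos, ?_⟩
  rw [← hFint]
  set N : X → ℝ≥0∞ := fun x => (if D x = 0 ∧ p x ≠ 0 then (⊤ : ℝ≥0∞)
            else ENNReal.ofReal (p x * (-Real.log (D x / E x)))) with hN
  have hNm : Measurable N := by
    refine Measurable.ite ?_ measurable_const (by fun_prop)
    exact (hDm (measurableSet_singleton 0)).inter (hpm (measurableSet_singleton 0)).compl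
  by_cases hNt : ∫⁻ x, N x ∂μ = ⊤
  · rw [hNt]
    simp
  · have hae : ∀ᵐ x ∂μ, ¬ (D x = 0 ∧ p x ≠ 0) := by
      filter_upwards [ae_lt_top hNm hNt] with x hx hc
      simp [hN, hc] at hx
    have hNeq : ∫⁻ x, N x ∂μ = ∫⁻ x, ENNReal.ofReal (-(p x * Real.log (D x / E x))) ∂μ := by
      refine lintegral_congr_ae ?_
      filter_upwards [hae] with x hx
      simp only [hN, if_neg hx, mul_neg]
    rw [hNeq] at hNt ⊢
    have hgi : Integrable (fun x => p x * Real.log (D x / E x)) μ := by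
      refine ⟨hgm.aestronglyMeasurable, ?_⟩
      rw [hasFiniteIntegral_iff_norm]
      refine lt_of_le_of_lt (lintegral_mono (g := fun x =>
        ENNReal.ofReal (p x * Real.log (D x / E x))
          + ENNReal.ofReal (-(p x * Real.log (D x / E x)))) fun x => ?_) ?_
      · rw [Real.norm_eq_abs]
        rcases abs_cases (p x * Real.log (D x / E x)) with h | h
        · rw [h.1]; exact le_self_add
        · rw [h.1]; exact le_add_self
      · rw [lintegral_add_left hgm.ennreal_ofReal]
        exact ENNReal.add_lt_top.2 ⟨lt_top_iff_ne_top.2 hpos, lt_top_iff_ne_top.2 hNt⟩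
    have hle : ∫ x, p x * Real.log (D x / E x) ∂μ ≤ ∫ x, F x ∂μ :=
      integral_mono_ae hgi hFi (by filter_upwards [hae] with x hx using hpt x hx)
    rw [integral_eq_lintegral_pos_part_sub_lintegral_neg_part hgi] at hle
    rw [← EReal.coe_ennreal_toReal hpos, ← EReal.coe_ennreal_toReal hNt, ← EReal.coe_sub]
    exact EReal.coe_le_coe_iff.2 hle

/-- Key population inequalities for the cross-entropy loss: for measurable `D : X → [0,1]`,
`∫ p₀ log(D/D_θ) dμ ≤ −∫(√D−√D_θ)²(p₀+p_θ)dμ + ∫(D−D_θ)(p₀+p_θ)dμ` and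
`∫ p_θ log((1−D)/(1−D_θ)) dμ ≤ −∫(√(1−D)−√(1−D_θ))²(p₀+p_θ)dμ − ∫(D−D_θ)(p₀+p_θ)dμ`.
Each left-hand integral is well defined in `[−∞,∞)`: its positive part (a lower
Lebesgue integral) is finite, and it is encoded in `EReal` as positive part minus
negative part, with the convention `log 0 = −∞` built into the negative part. -/
theorem stmt7 {X : Type*} [MeasurableSpace X] (μ : Measure X) [SigmaFinite μ]
    (p₀ pθ : X → ℝ) (hp₀m : Measurable p₀) (hpθm : Measurable pθ)
    (hp₀0 : ∀ x, 0 ≤ p₀ x) (hpθ0 : ∀ x, 0 ≤ pθ x)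
    (hp₀1 : ∫⁻ x, ENNReal.ofReal (p₀ x) ∂μ = 1)
    (hpθ1 : ∫⁻ x, ENNReal.ofReal (pθ x) ∂μ = 1)
    (D : X → ℝ) (hDm : Measurable D) (hD01 : ∀ x, D x ∈ Set.Icc (0 : ℝ) 1) :
    ((∫⁻ x, ENNReal.ofReal (p₀ x * Real.log (D x / oracleD p₀ pθ x)) ∂μ) ≠ ⊤ ∧
      ((∫⁻ x, ENNReal.ofReal (p₀ x * Real.log (D x / oracleD p₀ pθ x)) ∂μ : ℝ≥0∞) : EReal) -
        ((∫⁻ x, (if D x = 0 ∧ p₀ x ≠ 0 then (⊤ : ℝ≥0∞)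
            else ENNReal.ofReal (p₀ x * (-Real.log (D x / oracleD p₀ pθ x)))) ∂μ : ℝ≥0∞) : EReal) ≤
      ((- ∫ x, (Real.sqrt (D x) - Real.sqrt (oracleD p₀ pθ x)) ^ 2 * (p₀ x + pθ x) ∂μ
          + ∫ x, (D x - oracleD p₀ pθ x) * (p₀ x + pθ x) ∂μ : ℝ) : EReal)) ∧
    ((∫⁻ x, ENNReal.ofReal (pθ x * Real.log ((1 - D x) / (1 - oracleD p₀ pθ x))) ∂μ) ≠ ⊤ ∧
      ((∫⁻ x, ENNReal.ofReal (pθ x * Real.log ((1 - D x) / (1 - oracleD p₀ pθ x))) ∂μ : ℝ≥0∞) : EReal) -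
        ((∫⁻ x, (if D x = 1 ∧ pθ x ≠ 0 then (⊤ : ℝ≥0∞)
            else ENNReal.ofReal (pθ x * (-Real.log ((1 - D x) / (1 - oracleD p₀ pθ x))))) ∂μ : ℝ≥0∞) : EReal) ≤
      ((- ∫ x, (Real.sqrt (1 - D x) - Real.sqrt (1 - oracleD p₀ pθ x)) ^ 2 * (p₀ x + pθ x) ∂μ
          - ∫ x, (D x - oracleD p₀ pθ x) * (p₀ x + pθ x) ∂μ : ℝ) : EReal)) := by
  have hi : ∀ f : X → ℝ, Measurable f → (∀ x, 0 ≤ f x) →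
      ∫⁻ x, ENNReal.ofReal (f x) ∂μ = 1 → Integrable f μ := by
    intro f hm h0 h1
    refine ⟨hm.aestronglyMeasurable, ?_⟩
    rw [hasFiniteIntegral_iff_ofReal (Filter.Eventually.of_forall h0), h1]
    exact ENNReal.one_lt_top
  have hsi : Integrable (fun x => p₀ x + pθ x) μ :=
    (hi p₀ hp₀m hp₀0 hp₀1).add (hi pθ hpθm hpθ0 hpθ1)
  have hEm : Measurable (oracleD p₀ pθ) := by
    unfold oracleD
    exact Measurable.ite (measurableSet_lt measurable_const (hp₀m.add hpθm))
      (hp₀m.div (hp₀m.add hpθm)) measurable_const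
  have hs : ∀ x, 0 ≤ p₀ x + pθ x := fun x => add_nonneg (hp₀0 x) (hpθ0 x)
  have hp : ∀ x, p₀ x = oracleD p₀ pθ x * (p₀ x + pθ x) := by
    intro x
    unfold oracleD
    split_ifs with h
    · rw [div_mul_cancel₀ _ h.ne']
    · linarith [hp₀0 x, hpθ0 x]
  have hE : ∀ x, oracleD p₀ pθ x ∈ Set.Icc (0 : ℝ) 1 := by
    intro x
    unfold oracleD
    split_ifs with h
    · exact ⟨div_nonneg (hp₀0 x) h.le, (div_le_one h).2 (by linarith [hpθ0 x])⟩
    · norm_num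
  refine ⟨key_integral μ p₀ (fun x => p₀ x + pθ x) D (oracleD p₀ pθ) hp₀m hsi hDm hEm hs hp hD01 hE,
    ?_⟩
  have key := key_integral μ pθ (fun x => p₀ x + pθ x) (fun x => 1 - D x)
    (fun x => 1 - oracleD p₀ pθ x) hpθm hsi (measurable_const.sub hDm) (measurable_const.sub hEm) hs
    (fun x => by have := hp x; linarith)
    (fun x => ⟨by linarith [(hD01 x).2], by linarith [(hD01 x).1]⟩)
    (fun x => ⟨by linarith [(hE x).2], by linarith [(hE x).1]⟩)
  have e1 : ∀ x, (1 - D x = 0) = (D x = 1) := fun x => by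
    rw [sub_eq_zero]; exact propext eq_comm
  have e2 : ∫ x, (1 - D x - (1 - oracleD p₀ pθ x)) * (p₀ x + pθ x) ∂μ
      = - ∫ x, (D x - oracleD p₀ pθ x) * (p₀ x + pθ x) ∂μ := by
    rw [← integral_neg]
    congr 1
    funext x
    ring
  simp only [e1] at key
  rw [e2, ← sub_eq_add_neg] at key
  exact key
end

section
/- Let (X, 𝒜, μ) be a σ-finite measure space, let p₀ and p_θ be probability densities with respect to μ, and let D_θ = p₀/(p₀+p_θ) (set to 1/2 where p₀+p_θ = 0). Define, for measurable D₁, D₂ : X → [0,1], h_θ(D₁,D₂)² := ∫ (√D₁ − √D₂)² (p₀+p_θ) dμ and d_θ(D₁,D₂)² := h_θ(D₁,D₂)² + h_θ(1−D₁,1−D₂)². Then for every measurable D : X → [0,1], ∫ p₀ · log(D/D_θ) dμ + ∫ p_θ · log((1−D)/(1−D_θ)) dμ ≤ − d_θ(D,D_θ)², where each integral on the left is well defined in [−∞,∞). In other words, the population cross-entropy deficiency M_θ(D) − M_θ(D_θ) is at most −d_θ(D,D_θ)². -/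
open MeasureTheory
open scoped ENNReal

lemma key_pt {s E D p : ℝ} (hs : 0 ≤ s) (hE : 0 ≤ E) (hD : 0 ≤ D) (hp : p = s * E)
    (hn : ¬ (D = 0 ∧ p ≠ 0)) :
    p * Real.log (D / E) ≤ 2 * s * (Real.sqrt D * Real.sqrt E - E) := by
  by_cases h0 : p = 0
  · rw [h0] at hp
    rcases mul_eq_zero.mp hp.symm with h | h <;> simp [h0, h]
  have hE' : 0 < E := lt_of_le_of_ne hE (by rintro rfl; simp at hp; exact h0 hp)
  have hD' : 0 < D := lt_of_le_of_ne hD (fun h => hn ⟨h.symm, h0⟩)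
  have hse : 0 < Real.sqrt E := Real.sqrt_pos.mpr hE'
  have hsd : 0 < Real.sqrt D := Real.sqrt_pos.mpr hD'
  have e1 : Real.sqrt E * Real.sqrt E = E := Real.mul_self_sqrt hE
  have e2 : Real.sqrt D * Real.sqrt D = D := Real.mul_self_sqrt hD
  have hl : Real.log (D / E) = 2 * Real.log (Real.sqrt D / Real.sqrt E) := by
    rw [Real.log_div hD'.ne' hE'.ne', Real.log_div hsd.ne' hse.ne', Real.log_sqrt hD,
      Real.log_sqrt hE]
    ring
  have h1 := Real.log_le_sub_one_of_pos (div_pos hsd hse)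
  have h2 : E * (Real.sqrt D / Real.sqrt E) = Real.sqrt D * Real.sqrt E := by
    rw [mul_div_assoc', div_eq_iff hse.ne', mul_assoc, e1, mul_comm]
  rw [hl, hp]
  calc s * E * (2 * Real.log (Real.sqrt D / Real.sqrt E))
      ≤ s * E * (2 * (Real.sqrt D / Real.sqrt E - 1)) := by gcongr
    _ = 2 * s * (E * (Real.sqrt D / Real.sqrt E) - E) := by ring
    _ = _ := by rw [h2]

lemma pos_pt {s E D p : ℝ} (hs : 0 ≤ s) (hE : 0 ≤ E) (hD : 0 ≤ D) (hD1 : D ≤ 1)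
    (hp : p = s * E) : p * Real.log (D / E) ≤ s := by
  rcases hE.eq_or_lt with h | h
  · simp [hp, ← h, hs]
  have h1 := Real.log_le_self (div_nonneg hD hE)
  rw [hp]
  calc s * E * Real.log (D / E) ≤ s * E * (D / E) := by gcongr
    _ = s * D := by field_simp
    _ ≤ s := mul_le_of_le_one_right hs hD1

open Classical in
lemma int_part {X : Type*} [MeasurableSpace X] (μ : Measure X) (f : X → ℝ) (hf : Measurable f)
    (B : X → Prop) (hB : MeasurableSet {x | B x})
    (hP : ∫⁻ x, ENNReal.ofReal (f x) ∂μ ≠ ⊤)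
    (hN : ∫⁻ x, (if B x then (⊤ : ℝ≥0∞) else ENNReal.ofReal (-f x)) ∂μ ≠ ⊤) :
    Integrable f μ ∧ (∀ᵐ x ∂μ, ¬ B x) ∧
    ((∫⁻ x, ENNReal.ofReal (f x) ∂μ : ℝ≥0∞) : EReal) -
      ((∫⁻ x, (if B x then (⊤ : ℝ≥0∞) else ENNReal.ofReal (-f x)) ∂μ : ℝ≥0∞) : EReal)
      = ((∫ x, f x ∂μ : ℝ) : EReal) := by
  have hm : Measurable (fun x => if B x then (⊤ : ℝ≥0∞) else ENNReal.ofReal (-f x)) :=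
    Measurable.ite hB measurable_const hf.neg.ennreal_ofReal
  have hae : ∀ᵐ x ∂μ, ¬ B x := by
    filter_upwards [ae_lt_top hm hN] with x hx hb
    simp [hb] at hx
  have heq : ∫⁻ x, (if B x then (⊤ : ℝ≥0∞) else ENNReal.ofReal (-f x)) ∂μ
      = ∫⁻ x, ENNReal.ofReal (-f x) ∂μ := by
    apply lintegral_congr_ae
    filter_upwards [hae] with x hx
    simp [hx]
  rw [heq] at hN ⊢
  have hi : Integrable f μ := by
    refine ⟨hf.aestronglyMeasurable, ?_⟩
    rw [hasFiniteIntegral_iff_norm]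
    calc ∫⁻ x, ENNReal.ofReal ‖f x‖ ∂μ
        ≤ ∫⁻ x, (ENNReal.ofReal (f x) + ENNReal.ofReal (-f x)) ∂μ := by
          apply lintegral_mono
          intro x
          rcases le_total 0 (f x) with h | h
          · simp [abs_of_nonneg h]
          · simp [abs_of_nonpos h]
      _ = _ := lintegral_add_left hf.ennreal_ofReal _
      _ < ⊤ := ENNReal.add_lt_top.mpr ⟨hP.lt_top, hN.lt_top⟩
  refine ⟨hi, hae, ?_⟩
  rw [integral_eq_lintegral_pos_part_sub_lintegral_neg_part hi, EReal.coe_sub,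
    EReal.coe_ennreal_toReal hP, EReal.coe_ennreal_toReal hN]

lemma ereal_bot {P : ℝ≥0∞} (hP : P ≠ ⊤) : (P : EReal) - ((⊤ : ℝ≥0∞) : EReal) = ⊥ := by
  simp

/-- Cross-entropy deficiency bound: for measurable `D : X → [0,1]`,
`∫ p₀ log(D/D_θ) dμ + ∫ p_θ log((1−D)/(1−D_θ)) dμ ≤ −d_θ(D,D_θ)²`, where
`d_θ(D,D_θ)² = ∫[(√D−√D_θ)² + (√(1−D)−√(1−D_θ))²](p₀+p_θ) dμ`.
Each integral on the left is well defined in `[−∞,∞)`: its positive part is finite,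
and it is encoded in `EReal` as positive minus negative part, with the convention
`log 0 = −∞` built into the negative parts. -/
theorem stmt8 {X : Type*} [MeasurableSpace X] (μ : Measure X) [SigmaFinite μ]
    (p₀ pθ : X → ℝ) (hp₀m : Measurable p₀) (hpθm : Measurable pθ)
    (hp₀0 : ∀ x, 0 ≤ p₀ x) (hpθ0 : ∀ x, 0 ≤ pθ x)
    (hp₀1 : ∫⁻ x, ENNReal.ofReal (p₀ x) ∂μ = 1)
    (hpθ1 : ∫⁻ x, ENNReal.ofReal (pθ x) ∂μ = 1)
    (D : X → ℝ) (hDm : Measurable D) (hD01 : ∀ x, D x ∈ Set.Icc (0 : ℝ) 1) :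
    (∫⁻ x, ENNReal.ofReal (p₀ x * Real.log (D x / oracleD p₀ pθ x)) ∂μ) ≠ ⊤ ∧
    (∫⁻ x, ENNReal.ofReal (pθ x * Real.log ((1 - D x) / (1 - oracleD p₀ pθ x))) ∂μ) ≠ ⊤ ∧
    (((∫⁻ x, ENNReal.ofReal (p₀ x * Real.log (D x / oracleD p₀ pθ x)) ∂μ : ℝ≥0∞) : EReal) -
        ((∫⁻ x, (if D x = 0 ∧ p₀ x ≠ 0 then (⊤ : ℝ≥0∞)
            else ENNReal.ofReal (p₀ x * (-Real.log (D x / oracleD p₀ pθ x)))) ∂μ : ℝ≥0∞) : EReal)) +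
      (((∫⁻ x, ENNReal.ofReal (pθ x * Real.log ((1 - D x) / (1 - oracleD p₀ pθ x))) ∂μ : ℝ≥0∞) : EReal) -
        ((∫⁻ x, (if D x = 1 ∧ pθ x ≠ 0 then (⊤ : ℝ≥0∞)
            else ENNReal.ofReal (pθ x * (-Real.log ((1 - D x) / (1 - oracleD p₀ pθ x))))) ∂μ : ℝ≥0∞) : EReal)) ≤
      ((- ∫ x, ((Real.sqrt (D x) - Real.sqrt (oracleD p₀ pθ x)) ^ 2 +
            (Real.sqrt (1 - D x) - Real.sqrt (1 - oracleD p₀ pθ x)) ^ 2) * (p₀ x + pθ x) ∂μ : ℝ) : EReal) := by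
  
  classical
  set E := oracleD p₀ pθ with hEdef
  have hEm : Measurable E := by
    unfold E oracleD
    exact Measurable.ite (measurableSet_lt measurable_const (hp₀m.add hpθm))
      (hp₀m.div (hp₀m.add hpθm)) measurable_const
  have hs : ∀ x, 0 ≤ p₀ x + pθ x := fun x => add_nonneg (hp₀0 x) (hpθ0 x)
  have hE : ∀ x, 0 ≤ E x ∧ E x ≤ 1 ∧ p₀ x = (p₀ x + pθ x) * E x := by
    intro x
    have a := hp₀0 x
    have b := hpθ0 x
    simp only [hEdef, oracleD]
    split_ifs with h
    · refine ⟨by positivity, ?_, ?_⟩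
      · rw [div_le_one h]; linarith
      · field_simp
    · refine ⟨by norm_num, by norm_num, by linarith⟩
  have hE2 : ∀ x, pθ x = (p₀ x + pθ x) * (1 - E x) := fun x => by
    have := (hE x).2.2
    linarith
  have hsfin : ∫⁻ x, ENNReal.ofReal (p₀ x + pθ x) ∂μ ≠ ⊤ := by
    have : ∫⁻ x, ENNReal.ofReal (p₀ x + pθ x) ∂μ
        = ∫⁻ x, (ENNReal.ofReal (p₀ x) + ENNReal.ofReal (pθ x)) ∂μ :=
      lintegral_congr fun x => ENNReal.ofReal_add (hp₀0 x) (hpθ0 x)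
    rw [this, lintegral_add_left hp₀m.ennreal_ofReal, hp₀1, hpθ1]
    simp
  have hsint : Integrable (fun x => p₀ x + pθ x) μ := by
    refine ⟨(hp₀m.add hpθm).aestronglyMeasurable, ?_⟩
    rw [hasFiniteIntegral_iff_ofReal (Filter.Eventually.of_forall hs)]
    exact hsfin.lt_top
  have hP1 : (∫⁻ x, ENNReal.ofReal (p₀ x * Real.log (D x / E x)) ∂μ) ≠ ⊤ :=
    ne_top_of_le_ne_top hsfin (lintegral_mono fun x => ENNReal.ofReal_le_ofReal
      (pos_pt (hs x) (hE x).1 (hD01 x).1 (hD01 x).2 (hE x).2.2))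
  have hP2 : (∫⁻ x, ENNReal.ofReal (pθ x * Real.log ((1 - D x) / (1 - E x))) ∂μ) ≠ ⊤ :=
    ne_top_of_le_ne_top hsfin (lintegral_mono fun x => ENNReal.ofReal_le_ofReal
      (pos_pt (hs x) (sub_nonneg.mpr (hE x).2.1) (sub_nonneg.mpr (hD01 x).2)
        (by linarith [(hD01 x).1]) (hE2 x)))
  refine ⟨hP1, hP2, ?_⟩
  simp only [mul_neg]
  by_cases hN1 : (∫⁻ x, (if D x = 0 ∧ p₀ x ≠ 0 then (⊤ : ℝ≥0∞)
            else ENNReal.ofReal (-(p₀ x * Real.log (D x / E x)))) ∂μ) = ⊤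
  · rw [hN1, ereal_bot hP1, EReal.bot_add]; exact bot_le
  by_cases hN2 : (∫⁻ x, (if D x = 1 ∧ pθ x ≠ 0 then (⊤ : ℝ≥0∞)
            else ENNReal.ofReal (-(pθ x * Real.log ((1 - D x) / (1 - E x))))) ∂μ) = ⊤
  · rw [hN2, ereal_bot hP2, EReal.add_bot]; exact bot_le
  have hB1 : MeasurableSet {x | D x = 0 ∧ p₀ x ≠ 0} :=
    (hDm (measurableSet_singleton 0)).inter (hp₀m (measurableSet_singleton 0)).compl
  have hB2 : MeasurableSet {x | D x = 1 ∧ pθ x ≠ 0} :=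
    (hDm (measurableSet_singleton 1)).inter (hpθm (measurableSet_singleton 0)).compl
  obtain ⟨i1, a1, e1⟩ := int_part μ (fun x => p₀ x * Real.log (D x / E x))
    (hp₀m.mul (hDm.div hEm).log) (fun x => D x = 0 ∧ p₀ x ≠ 0) hB1 hP1 (by convert hN1)
  obtain ⟨i2, a2, e2⟩ := int_part μ (fun x => pθ x * Real.log ((1 - D x) / (1 - E x)))
    (hpθm.mul ((measurable_const.sub hDm).div (measurable_const.sub hEm)).log)
    (fun x => D x = 1 ∧ pθ x ≠ 0) hB2 hP2 (by convert hN2)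
  have hq : ∀ x, ((Real.sqrt (D x) - Real.sqrt (E x)) ^ 2 +
      (Real.sqrt (1 - D x) - Real.sqrt (1 - E x)) ^ 2) * (p₀ x + pθ x) =
      -(2 * (p₀ x + pθ x) * (Real.sqrt (D x) * Real.sqrt (E x) - E x) +
        2 * (p₀ x + pθ x) * (Real.sqrt (1 - D x) * Real.sqrt (1 - E x) - (1 - E x))) := by
    intro x
    have t1 := Real.sq_sqrt (hD01 x).1
    have t2 := Real.sq_sqrt (hE x).1
    have t3 := Real.sq_sqrt (sub_nonneg.mpr (hD01 x).2)
    have t4 := Real.sq_sqrt (sub_nonneg.mpr (hE x).2.1)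
    rw [sub_sq, sub_sq, t1, t2, t3, t4]
    ring
  have i3 : Integrable (fun x => ((Real.sqrt (D x) - Real.sqrt (E x)) ^ 2 +
      (Real.sqrt (1 - D x) - Real.sqrt (1 - E x)) ^ 2) * (p₀ x + pθ x)) μ := by
    refine (hsint.const_mul 2).mono' (by fun_prop) (Filter.Eventually.of_forall fun x => ?_)
    have hsx := hs x
    rw [Real.norm_of_nonneg (by positivity), hq x]
    have u1 : 0 ≤ (p₀ x + pθ x) * (Real.sqrt (D x) * Real.sqrt (E x)) := by positivity
    have u2 : 0 ≤ (p₀ x + pθ x) * (Real.sqrt (1 - D x) * Real.sqrt (1 - E x)) := by positivity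
    linarith
  have main : (∫ x, p₀ x * Real.log (D x / E x) ∂μ) +
      (∫ x, pθ x * Real.log ((1 - D x) / (1 - E x)) ∂μ) ≤
      - ∫ x, ((Real.sqrt (D x) - Real.sqrt (E x)) ^ 2 +
      (Real.sqrt (1 - D x) - Real.sqrt (1 - E x)) ^ 2) * (p₀ x + pθ x) ∂μ := by
    rw [← integral_add i1 i2, ← integral_neg]
    refine integral_mono_ae (i1.add i2) i3.neg ?_
    filter_upwards [a1, a2] with x h1 h2
    have k1 := key_pt (hs x) (hE x).1 (hD01 x).1 (hE x).2.2 h1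
    have k2 := key_pt (hs x) (sub_nonneg.mpr (hE x).2.1) (sub_nonneg.mpr (hD01 x).2) (hE2 x)
      (fun h => h2 ⟨by linarith [h.1], h.2⟩)
    rw [hq x, neg_neg]
    exact add_le_add k1 k2
  have fin := EReal.coe_le_coe_iff.mpr main
  rw [EReal.coe_add, ← e1, ← e2] at fin
  convert fin
end

section
/- Let (X, 𝒜, μ) be a σ-finite measure space, let p₀ and p_θ be probability densities with respect to μ, and let D_θ = p₀/(p₀+p_θ) (set to 1/2 where p₀+p_θ = 0). Define h_θ(D₁,D₂)² := ∫ (√D₁ − √D₂)² (p₀+p_θ) dμ and d_θ(D₁,D₂)² := h_θ(D₁,D₂)² + h_θ(1−D₁,1−D₂)². Then for every measurable D : X → [0,1], ∫ p₀ · log( (D+D_θ)/(2D_θ) ) dμ + ∫ p_θ · log( ((1−D)+(1−D_θ))/(2(1−D_θ)) ) dμ ≤ − d_θ(D,D_θ)² / (1+√2)², where each integral on the left is well defined in [−∞,∞). -/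
open MeasureTheory
open scoped ENNReal

lemma aux_log_s9 (u : ℝ) (hu : 0 ≤ u) :
    Real.log ((u ^ 2 + 1) / 2) ≤ (u ^ 2 - 1) / 2 - 0.1716 * (u - 1) ^ 2 := by
  rcases le_total u (1 / 2) with h | h
  · have h1 : Real.log (u ^ 2 + 1) ≤ u ^ 2 := by
      have := Real.log_le_sub_one_of_pos (show 0 < u ^ 2 + 1 by positivity)
      linarith
    rw [Real.log_div (by positivity) (by norm_num)]
    have := Real.log_two_gt_d9
    nlinarith [mul_nonneg hu (sub_nonneg.2 h)]
  · set y := (u ^ 2 + 1) / 2 with hy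
    have hy0 : 0 < y := by positivity
    set w := Real.sqrt y with hw
    have hw0 : 0 < w := Real.sqrt_pos.2 hy0
    have hw2 : w ^ 2 = y := Real.sq_sqrt hy0.le
    have h1 : Real.log y ≤ 2 * (w - 1) := by
      rw [← hw2, Real.log_pow]
      have := Real.log_le_sub_one_of_pos hw0
      push_cast
      linarith
    have h2 : 0.1716 * (u - 1) ^ 2 ≤ (w - 1) ^ 2 := by
      have h3 : (w - 1) ^ 2 * (w + 1) ^ 2 = (u - 1) ^ 2 * ((u + 1) ^ 2 / 4) := by
        have : (w - 1) ^ 2 * (w + 1) ^ 2 = (w ^ 2 - 1) ^ 2 := by ring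
        rw [this, hw2, hy]; ring
      have h4 : (w + 1) ^ 2 ≤ u ^ 2 + 3 := by nlinarith [sq_nonneg (w - 1)]
      have h5 : 0.1716 * (u ^ 2 + 3) ≤ (u + 1) ^ 2 / 4 := by nlinarith
      have h6 : (0.1716 * (u - 1) ^ 2) * (w + 1) ^ 2 ≤ (w - 1) ^ 2 * (w + 1) ^ 2 := by
        rw [h3]
        nlinarith [mul_le_mul_of_nonneg_left h4 (sq_nonneg (u - 1)),
          mul_le_mul_of_nonneg_left h5 (sq_nonneg (u - 1))]
      exact le_of_mul_le_mul_right h6 (by positivity)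
    nlinarith

lemma aux_c : 1 / (1 + Real.sqrt 2) ^ 2 ≤ 0.1716 := by
  have h : (1.4142 : ℝ) ≤ Real.sqrt 2 := Real.le_sqrt_of_sq_le (by norm_num)
  rw [div_le_iff₀ (by positivity)]
  nlinarith [Real.sq_sqrt (show (0 : ℝ) ≤ 2 by norm_num)]

lemma aux_pt_s9 (D d : ℝ) (hD : 0 ≤ D) (hd : 0 ≤ d) :
    d * Real.log ((D + d) / (2 * d)) ≤
      (D - d) / 2 - (Real.sqrt D - Real.sqrt d) ^ 2 / (1 + Real.sqrt 2) ^ 2 := by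
  have hc : (Real.sqrt D - Real.sqrt d) ^ 2 / (1 + Real.sqrt 2) ^ 2
      ≤ 0.1716 * (Real.sqrt D - Real.sqrt d) ^ 2 := by
    have := mul_le_mul_of_nonneg_right aux_c (sq_nonneg (Real.sqrt D - Real.sqrt d))
    calc _ = 1 / (1 + Real.sqrt 2) ^ 2 * (Real.sqrt D - Real.sqrt d) ^ 2 := by ring
      _ ≤ _ := this
  refine le_trans ?_ (sub_le_sub_left hc _)
  obtain ⟨a, ha, rfl⟩ : ∃ a : ℝ, 0 ≤ a ∧ D = a ^ 2 :=
    ⟨Real.sqrt D, Real.sqrt_nonneg _, (Real.sq_sqrt hD).symm⟩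
  obtain ⟨b, hb, rfl⟩ : ∃ b : ℝ, 0 ≤ b ∧ d = b ^ 2 :=
    ⟨Real.sqrt d, Real.sqrt_nonneg _, (Real.sq_sqrt hd).symm⟩
  rw [Real.sqrt_sq ha, Real.sqrt_sq hb]
  rcases hb.eq_or_lt with rfl | hb
  · norm_num
    nlinarith [sq_nonneg a]
  · have h := mul_le_mul_of_nonneg_left (aux_log_s9 (a / b) (by positivity)) hd
    have e1 : (a ^ 2 + b ^ 2) / (2 * b ^ 2) = ((a / b) ^ 2 + 1) / 2 := by
      field_simp
    have e2 : b ^ 2 * (((a / b) ^ 2 - 1) / 2 - 0.1716 * (a / b - 1) ^ 2)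
        = (a ^ 2 - b ^ 2) / 2 - 0.1716 * (a - b) ^ 2 := by
      field_simp
    rw [e1, ← e2]
    exact h

lemma aux_lower (D d : ℝ) (hD : 0 ≤ D) (hd : 0 ≤ d) :
    - d ≤ d * Real.log ((D + d) / (2 * d)) := by
  rcases hd.eq_or_lt with rfl | hd
  · simp
  · have h : Real.log (1 / 2) ≤ Real.log ((D + d) / (2 * d)) := by
      apply Real.log_le_log (by norm_num)
      rw [div_le_div_iff₀ (by norm_num) (by positivity)]
      linarith
    have h2 : Real.log (1 / 2) = - Real.log 2 := by simp
    have := Real.log_two_lt_d9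
    nlinarith

lemma aux_ereal {X : Type*} [MeasurableSpace X] (μ : Measure X) (f : X → ℝ)
    (hf : Integrable f μ) :
    (∫⁻ x, ENNReal.ofReal (f x) ∂μ) ≠ ⊤ ∧
    ((∫⁻ x, ENNReal.ofReal (f x) ∂μ : ℝ≥0∞) : EReal) -
      ((∫⁻ x, ENNReal.ofReal (- f x) ∂μ : ℝ≥0∞) : EReal) = ((∫ x, f x ∂μ : ℝ) : EReal) := by
  have h1 : (∫⁻ x, ENNReal.ofReal (f x) ∂μ) ≠ ⊤ := hf.lintegral_lt_top.ne
  have h2 : (∫⁻ x, ENNReal.ofReal (- f x) ∂μ) ≠ ⊤ := hf.neg.lintegral_lt_top.ne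
  refine ⟨h1, ?_⟩
  rw [integral_eq_lintegral_pos_part_sub_lintegral_neg_part hf, EReal.coe_sub,
    EReal.coe_ennreal_toReal h1, EReal.coe_ennreal_toReal h2]

/-- Curvature of the pseudo-cross-entropy objective: for measurable `D : X → [0,1]`,
`∫ p₀ log((D+D_θ)/(2D_θ)) dμ + ∫ p_θ log(((1−D)+(1−D_θ))/(2(1−D_θ))) dμ
  ≤ −d_θ(D,D_θ)²/(1+√2)²`, where
`d_θ(D,D_θ)² = ∫[(√D−√D_θ)² + (√(1−D)−√(1−D_θ))²](p₀+p_θ) dμ`.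
Each integral on the left is well defined in `[−∞,∞)`: its positive part is finite,
and it is encoded in `EReal` as positive part minus negative part. -/
theorem stmt9 {X : Type*} [MeasurableSpace X] (μ : Measure X) [SigmaFinite μ]
    (p₀ pθ : X → ℝ) (hp₀m : Measurable p₀) (hpθm : Measurable pθ)
    (hp₀0 : ∀ x, 0 ≤ p₀ x) (hpθ0 : ∀ x, 0 ≤ pθ x)
    (hp₀1 : ∫⁻ x, ENNReal.ofReal (p₀ x) ∂μ = 1)
    (hpθ1 : ∫⁻ x, ENNReal.ofReal (pθ x) ∂μ = 1)
    (D : X → ℝ) (hDm : Measurable D) (hD01 : ∀ x, D x ∈ Set.Icc (0 : ℝ) 1) :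
    (∫⁻ x, ENNReal.ofReal
        (p₀ x * Real.log ((D x + oracleD p₀ pθ x) / (2 * oracleD p₀ pθ x))) ∂μ) ≠ ⊤ ∧
    (∫⁻ x, ENNReal.ofReal
        (pθ x * Real.log (((1 - D x) + (1 - oracleD p₀ pθ x)) / (2 * (1 - oracleD p₀ pθ x)))) ∂μ) ≠ ⊤ ∧
    (((∫⁻ x, ENNReal.ofReal
          (p₀ x * Real.log ((D x + oracleD p₀ pθ x) / (2 * oracleD p₀ pθ x))) ∂μ : ℝ≥0∞) : EReal) -
        ((∫⁻ x, ENNReal.ofReal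
          (p₀ x * (-Real.log ((D x + oracleD p₀ pθ x) / (2 * oracleD p₀ pθ x)))) ∂μ : ℝ≥0∞) : EReal)) +
      (((∫⁻ x, ENNReal.ofReal
          (pθ x * Real.log (((1 - D x) + (1 - oracleD p₀ pθ x)) / (2 * (1 - oracleD p₀ pθ x)))) ∂μ : ℝ≥0∞) : EReal) -
        ((∫⁻ x, ENNReal.ofReal
          (pθ x * (-Real.log (((1 - D x) + (1 - oracleD p₀ pθ x)) / (2 * (1 - oracleD p₀ pθ x))))) ∂μ : ℝ≥0∞) : EReal)) ≤
      ((- (∫ x, ((Real.sqrt (D x) - Real.sqrt (oracleD p₀ pθ x)) ^ 2 +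
              (Real.sqrt (1 - D x) - Real.sqrt (1 - oracleD p₀ pθ x)) ^ 2) * (p₀ x + pθ x) ∂μ) /
            (1 + Real.sqrt 2) ^ 2 : ℝ) : EReal) := by
  set d := oracleD p₀ pθ with hd
  have hdm : Measurable d := by
    refine Measurable.ite (measurableSet_lt measurable_const (hp₀m.add hpθm)) ?_ measurable_const
    exact hp₀m.div (hp₀m.add hpθm)
  have hp0 : ∀ x, p₀ x = (p₀ x + pθ x) * d x := by
    intro x
    simp only [hd, oracleD]
    split_ifs with h
    · field_simp
    · linarith [hp₀0 x, hpθ0 x]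
  have hpt : ∀ x, pθ x = (p₀ x + pθ x) * (1 - d x) := by
    intro x
    linarith [hp0 x]
  have hd0 : ∀ x, 0 ≤ d x ∧ d x ≤ 1 := by
    intro x
    simp only [hd, oracleD]
    split_ifs with h
    · exact ⟨div_nonneg (hp₀0 x) h.le, (div_le_one h).2 (by linarith [hpθ0 x])⟩
    · norm_num
  have hs : ∀ x, 0 ≤ p₀ x + pθ x := fun x => add_nonneg (hp₀0 x) (hpθ0 x)
  have i0 : Integrable p₀ μ := ⟨hp₀m.aestronglyMeasurable, by
    rw [hasFiniteIntegral_iff_ofReal (Filter.Eventually.of_forall hp₀0), hp₀1]; simp⟩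
  have i1 : Integrable pθ μ := ⟨hpθm.aestronglyMeasurable, by
    rw [hasFiniteIntegral_iff_ofReal (Filter.Eventually.of_forall hpθ0), hpθ1]; simp⟩
  have is := i0.add i1
  set f : X → ℝ := fun x => p₀ x * Real.log ((D x + d x) / (2 * d x)) with hf
  set g : X → ℝ := fun x =>
    pθ x * Real.log (((1 - D x) + (1 - d x)) / (2 * (1 - d x))) with hg
  have fe : ∀ x, f x = (p₀ x + pθ x) * (d x * Real.log ((D x + d x) / (2 * d x))) := by
    intro x
    rw [← mul_assoc, ← hp0 x]
  have ge : ∀ x, g x = (p₀ x + pθ x) *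
      ((1 - d x) * Real.log (((1 - D x) + (1 - d x)) / (2 * (1 - d x)))) := by
    intro x
    rw [← mul_assoc, ← hpt x]
  have fu := fun x => aux_pt_s9 (D x) (d x) (hD01 x).1 (hd0 x).1
  have gu := fun x => aux_pt_s9 (1 - D x) (1 - d x) (by linarith [(hD01 x).2])
    (by linarith [(hd0 x).2])
  have fl := fun x => aux_lower (D x) (d x) (hD01 x).1 (hd0 x).1
  have gl := fun x => aux_lower (1 - D x) (1 - d x) (by linarith [(hD01 x).2])
    (by linarith [(hd0 x).2])
  have fi : Integrable f μ := by
    refine is.mono' (Measurable.aestronglyMeasurable (by fun_prop))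
      (Filter.Eventually.of_forall fun x => ?_)
    rw [Real.norm_eq_abs, fe, abs_mul, abs_of_nonneg (hs x)]
    refine mul_le_of_le_one_right (hs x) (abs_le.2 ⟨?_, ?_⟩)
    · linarith [fl x, (hd0 x).2]
    · have : 0 ≤ (Real.sqrt (D x) - Real.sqrt (d x)) ^ 2 / (1 + Real.sqrt 2) ^ 2 := by positivity
      linarith [fu x, (hd0 x).1, (hD01 x).2]
  have gi : Integrable g μ := by
    refine is.mono' (Measurable.aestronglyMeasurable (by fun_prop))
      (Filter.Eventually.of_forall fun x => ?_)
    rw [Real.norm_eq_abs, ge, abs_mul, abs_of_nonneg (hs x)]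
    refine mul_le_of_le_one_right (hs x) (abs_le.2 ⟨?_, ?_⟩)
    · linarith [gl x, (hd0 x).1]
    · have : 0 ≤ (Real.sqrt (1 - D x) - Real.sqrt (1 - d x)) ^ 2 / (1 + Real.sqrt 2) ^ 2 := by
        positivity
      linarith [gu x, (hd0 x).2, (hD01 x).1]
  obtain ⟨f1, f2⟩ := aux_ereal μ f fi
  obtain ⟨g1, g2⟩ := aux_ereal μ g gi
  refine ⟨f1, g1, ?_⟩
  simp only [mul_neg]
  change ((∫⁻ x, ENNReal.ofReal (f x) ∂μ : ℝ≥0∞) : EReal) -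
      ((∫⁻ x, ENNReal.ofReal (- f x) ∂μ : ℝ≥0∞) : EReal) +
      (((∫⁻ x, ENNReal.ofReal (g x) ∂μ : ℝ≥0∞) : EReal) -
      ((∫⁻ x, ENNReal.ofReal (- g x) ∂μ : ℝ≥0∞) : EReal)) ≤ _
  rw [f2, g2, ← EReal.coe_add, EReal.coe_le_coe_iff, ← integral_add fi gi, ← integral_neg,
    ← integral_div]
  have sq1 : ∀ a b : ℝ, 0 ≤ a → a ≤ 1 → 0 ≤ b → b ≤ 1 →
      (Real.sqrt a - Real.sqrt b) ^ 2 ≤ 1 := by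
    intro a b ha ha1 hb hb1
    have h1 := Real.sqrt_nonneg a
    have h2 := Real.sqrt_nonneg b
    have h3 := Real.sqrt_le_one.2 ha1
    have h4 := Real.sqrt_le_one.2 hb1
    rw [sq_le_one_iff_abs_le_one, abs_le]
    constructor <;> linarith
  have hi : Integrable (fun x => ((Real.sqrt (D x) - Real.sqrt (d x)) ^ 2 +
      (Real.sqrt (1 - D x) - Real.sqrt (1 - d x)) ^ 2) * (p₀ x + pθ x)) μ := by
    refine (is.const_mul 2).mono' (Measurable.aestronglyMeasurable (by fun_prop))
      (Filter.Eventually.of_forall fun x => ?_)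
    rw [Real.norm_eq_abs, abs_mul, abs_of_nonneg (hs x), abs_of_nonneg (by positivity)]
    refine mul_le_mul_of_nonneg_right ?_ (hs x)
    have hD := hD01 x
    have := sq1 (D x) (d x) hD.1 hD.2 (hd0 x).1 (hd0 x).2
    have := sq1 (1 - D x) (1 - d x) (by linarith [hD.2]) (by linarith [hD.1])
      (by linarith [(hd0 x).2]) (by linarith [(hd0 x).1])
    linarith
  refine integral_mono (fi.add gi) (hi.neg.div_const _) fun x => ?_
  have h := mul_le_mul_of_nonneg_left (add_le_add (fu x) (gu x)) (hs x)
  rw [mul_add, ← fe x, ← ge x] at h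
  refine h.trans (le_of_eq ?_)
  ring
end

section
/- Let (X, 𝒜, μ) be a σ-finite measure space, let p₀ and p_θ be probability densities with respect to μ, and let D_θ = p₀/(p₀+p_θ) (set to 1/2 where p₀+p_θ = 0). For a measurable D : X → [0,1], define m₁ := log((D+D_θ)/(2D_θ)) on {p₀ > 0} and m₂ := log(((1−D)+(1−D_θ))/(2(1−D_θ))) on {p_θ > 0}. Then 2·∫ ( e^{|m₁|} − 1 − |m₁| ) p₀ dμ ≤ 4·∫ (√D − √D_θ)² (p₀+p_θ) dμ and 2·∫ ( e^{|m₂|} − 1 − |m₂| ) p_θ dμ ≤ 4·∫ (√(1−D) − √(1−D_θ))² (p₀+p_θ) dμ. -/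
open MeasureTheory
open scoped ENNReal

/-- Pointwise bound. -/
theorem bern_pt (d q : ℝ) (hd : 0 ≤ d) (hq : 0 < q) :
    (Real.exp |Real.log ((d + q) / (2 * q))| - 1 - |Real.log ((d + q) / (2 * q))|) * q ≤
      (Real.sqrt d - Real.sqrt q) ^ 2 := by
  have hy : 0 < (d + q) / (2 * q) := by positivity
  have h1 : ∀ y : ℝ, 0 < y → Real.exp |Real.log y| - 1 - |Real.log y| ≤ y + y⁻¹ - 2 := by
    intro y hy
    rcases le_total 0 (Real.log y) with h | h
    · rw [abs_of_nonneg h, Real.exp_log hy]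
      have := Real.one_sub_inv_le_log_of_pos hy
      linarith
    · rw [abs_of_nonpos h, Real.exp_neg, Real.exp_log hy]
      have := Real.log_le_sub_one_of_pos hy
      linarith
  refine (mul_le_mul_of_nonneg_right (h1 _ hy) hq.le).trans ?_
  obtain ⟨a, ha, rfl⟩ : ∃ a : ℝ, 0 ≤ a ∧ d = a ^ 2 :=
    ⟨√d, Real.sqrt_nonneg _, (Real.sq_sqrt hd).symm⟩
  obtain ⟨b, hb, rfl⟩ : ∃ b : ℝ, 0 < b ∧ q = b ^ 2 :=
    ⟨√q, Real.sqrt_pos.2 hq, (Real.sq_sqrt hq.le).symm⟩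
  rw [Real.sqrt_sq ha, Real.sqrt_sq hb.le]
  have e : ((a ^ 2 + b ^ 2) / (2 * b ^ 2) + ((a ^ 2 + b ^ 2) / (2 * b ^ 2))⁻¹ - 2) * b ^ 2
      = (a - b) ^ 2 * ((a + b) ^ 2 / (2 * (a ^ 2 + b ^ 2))) := by
    field_simp
    ring
  rw [e]
  refine mul_le_of_le_one_right (sq_nonneg _) ?_
  rw [div_le_one (by positivity)]
  nlinarith [sq_nonneg (a - b)]

theorem bern_int {X : Type*} [MeasurableSpace X] (μ : Measure X) (p s D q : X → ℝ)
    (hp : Measurable p) (hD : ∀ x, 0 ≤ D x) (hs : ∀ x, 0 < p x → 0 < s x)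
    (hq : ∀ x, 0 < p x → q x = p x / s x) :
    2 * ∫⁻ x in {x | 0 < p x}, ENNReal.ofReal
        ((Real.exp |Real.log ((D x + q x) / (2 * q x))| - 1 -
            |Real.log ((D x + q x) / (2 * q x))|) * p x) ∂μ ≤
      4 * ∫⁻ x, ENNReal.ofReal ((Real.sqrt (D x) - Real.sqrt (q x)) ^ 2 * s x) ∂μ := by
  refine mul_le_mul' (by norm_num) ?_
  refine (setLIntegral_mono' (measurableSet_lt measurable_const hp) ?_).trans
    (setLIntegral_le_lintegral {x | 0 < p x} _)
  intro x hx
  have hx : 0 < p x := hx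
  have hsx := hs x hx
  apply ENNReal.ofReal_le_ofReal
  have hqx : 0 < q x := by rw [hq x hx]; positivity
  have hps : p x = q x * s x := by rw [hq x hx]; field_simp
  have := mul_le_mul_of_nonneg_right (bern_pt (D x) (q x) (hD x) hqx) hsx.le
  rwa [mul_assoc, ← hps] at this

/-- Bernstein-'norm' bounds for the pseudo-cross-entropy functions: with
`m₁ = log((D+D_θ)/(2D_θ))` on `{p₀ > 0}` and `m₂ = log(((1−D)+(1−D_θ))/(2(1−D_θ)))`
on `{p_θ > 0}`,
`2∫(e^{|m₁|}−1−|m₁|) p₀ dμ ≤ 4∫(√D−√D_θ)²(p₀+p_θ) dμ` and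
`2∫(e^{|m₂|}−1−|m₂|) p_θ dμ ≤ 4∫(√(1−D)−√(1−D_θ))²(p₀+p_θ) dμ`. -/
theorem stmt10 {X : Type*} [MeasurableSpace X] (μ : Measure X) [SigmaFinite μ]
    (p₀ pθ : X → ℝ) (hp₀m : Measurable p₀) (hpθm : Measurable pθ)
    (hp₀0 : ∀ x, 0 ≤ p₀ x) (hpθ0 : ∀ x, 0 ≤ pθ x)
    (hp₀1 : ∫⁻ x, ENNReal.ofReal (p₀ x) ∂μ = 1)
    (hpθ1 : ∫⁻ x, ENNReal.ofReal (pθ x) ∂μ = 1)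
    (D : X → ℝ) (hDm : Measurable D) (hD01 : ∀ x, D x ∈ Set.Icc (0 : ℝ) 1) :
    2 * ∫⁻ x in {x | 0 < p₀ x}, ENNReal.ofReal
        ((Real.exp |Real.log ((D x + oracleD p₀ pθ x) / (2 * oracleD p₀ pθ x))| - 1 -
            |Real.log ((D x + oracleD p₀ pθ x) / (2 * oracleD p₀ pθ x))|) * p₀ x) ∂μ ≤
      4 * ∫⁻ x, ENNReal.ofReal
        ((Real.sqrt (D x) - Real.sqrt (oracleD p₀ pθ x)) ^ 2 * (p₀ x + pθ x)) ∂μ ∧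
    2 * ∫⁻ x in {x | 0 < pθ x}, ENNReal.ofReal
        ((Real.exp |Real.log (((1 - D x) + (1 - oracleD p₀ pθ x)) /
              (2 * (1 - oracleD p₀ pθ x)))| - 1 -
            |Real.log (((1 - D x) + (1 - oracleD p₀ pθ x)) /
              (2 * (1 - oracleD p₀ pθ x)))|) * pθ x) ∂μ ≤
      4 * ∫⁻ x, ENNReal.ofReal
        ((Real.sqrt (1 - D x) - Real.sqrt (1 - oracleD p₀ pθ x)) ^ 2 * (p₀ x + pθ x)) ∂μ := by
  constructor
  · refine bern_int μ p₀ (fun x => p₀ x + pθ x) D (oracleD p₀ pθ) hp₀m (fun x => (hD01 x).1)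
      (fun x hx => by have := hpθ0 x; positivity) (fun x hx => ?_)
    have := hpθ0 x
    have h : 0 < p₀ x + pθ x := by positivity
    simp [oracleD, h]
  · refine bern_int μ pθ (fun x => p₀ x + pθ x) (fun x => 1 - D x)
      (fun x => 1 - oracleD p₀ pθ x) hpθm (fun x => sub_nonneg.2 (hD01 x).2)
      (fun x hx => by have := hp₀0 x; positivity) (fun x hx => ?_)
    have := hp₀0 x
    have h : 0 < p₀ x + pθ x := by positivity
    simp only [oracleD, h, if_true]
    field_simp
    ring
end

section
/- Let (X, 𝒜, μ) be a σ-finite measure space, let p₀ be a probability density with respect to μ, and let ℓ, u : X → [0,∞) be measurable functions with ℓ ≤ u pointwise. Then, with r := (p₀+u)/(p₀+ℓ) ≥ 1 on {p₀ > 0}, 2·∫_{{p₀>0}} ( e^{log r} − 1 − log r ) p₀ dμ ≤ 4·∫ (√u − √ℓ)² dμ. -/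
open MeasureTheory
open scoped ENNReal

theorem log_aux (s : ℝ) (hs : 1 ≤ s) : s ^ 2 - 1 - 2 * Real.log s ≤ 2 * (s - 1) ^ 2 := by
  have h := Real.le_log_one_add_of_nonneg (x := s - 1) (by linarith)
  have e : 1 + (s - 1) = s := by ring
  rw [e] at h
  have h2 : (s - 1) * (3 - s) / 2 ≤ 2 * (s - 1) / (s - 1 + 2) := by
    rw [div_le_div_iff₀ (by norm_num) (by linarith)]
    nlinarith [mul_nonneg (sub_nonneg.2 hs) (sq_nonneg (s - 1))]
  nlinarith

theorem pt_aux (p l u : ℝ) (hp : 0 < p) (hl : 0 ≤ l) (hlu : l ≤ u) :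
    (Real.exp (Real.log ((p + u) / (p + l))) - 1 - Real.log ((p + u) / (p + l))) * p
      ≤ 2 * (Real.sqrt u - Real.sqrt l) ^ 2 := by
  have hu : 0 ≤ u := hl.trans hlu
  have hA2 := Real.sq_sqrt (show 0 ≤ p + u by linarith)
  have hB2 := Real.sq_sqrt (show 0 ≤ p + l by linarith)
  have ha2 := Real.sq_sqrt hu
  have hb2 := Real.sq_sqrt hl
  have hB : 0 < √(p + l) := Real.sqrt_pos.2 (by linarith)
  have hAB : √(p + l) ≤ √(p + u) := Real.sqrt_le_sqrt (by linarith)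
  have hab : √l ≤ √u := Real.sqrt_le_sqrt hlu
  have haA : √u ≤ √(p + u) := Real.sqrt_le_sqrt (by linarith)
  have hbB : √l ≤ √(p + l) := Real.sqrt_le_sqrt (by linarith)
  have hr : (p + u) / (p + l) = (√(p + u) / √(p + l)) ^ 2 := by
    rw [div_pow, hA2, hB2]
  rw [Real.exp_log (div_pos (by linarith) (by linarith)), hr, Real.log_pow]
  have hpB : p ≤ √(p + l) ^ 2 := by rw [hB2]; linarith
  have hb0 := Real.sqrt_nonneg l
  generalize √(p + u) = A at *
  generalize √(p + l) = B at *
  generalize √u = a at *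
  generalize √l = b at *
  have hs : 1 ≤ A / B := (one_le_div hB).2 hAB
  have h1 := log_aux (A / B) hs
  have hd : A - B ≤ a - b := by
    by_contra hc
    push Not at hc
    have e : (A - B) * (A + B) = (a - b) * (a + b) := by nlinarith
    have : (a - b) * (a + b) ≤ (a - b) * (A + B) :=
      mul_le_mul_of_nonneg_left (by linarith) (by linarith)
    have : (a - b) * (A + B) < (A - B) * (A + B) :=
      mul_lt_mul_of_pos_right hc (by linarith)
    linarith
  have hsq : (A - B) ^ 2 ≤ (a - b) ^ 2 := pow_le_pow_left₀ (by linarith) hd 2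
  calc _ ≤ (2 * (A / B - 1) ^ 2) * p :=
        mul_le_mul_of_nonneg_right (by push_cast; exact h1) hp.le
    _ ≤ (2 * (A / B - 1) ^ 2) * B ^ 2 := mul_le_mul_of_nonneg_left hpB (by positivity)
    _ = 2 * (A - B) ^ 2 := by field_simp
    _ ≤ _ := by linarith

/-- Bracketing-transfer bound for log oracle-discriminator ratios: for measurable
`ℓ ≤ u` with values in `[0,∞)`, the ratio `r = (p₀+u)/(p₀+ℓ)` satisfies `r ≥ 1` on
`{p₀ > 0}` and `2∫_{p₀>0}(e^{log r} − 1 − log r) p₀ dμ ≤ 4∫(√u−√ℓ)² dμ`. -/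
theorem stmt12 {X : Type*} [MeasurableSpace X] (μ : Measure X) [SigmaFinite μ]
    (p₀ : X → ℝ) (hp₀m : Measurable p₀) (hp₀0 : ∀ x, 0 ≤ p₀ x)
    (hp₀1 : ∫⁻ x, ENNReal.ofReal (p₀ x) ∂μ = 1)
    (l u : X → ℝ) (hlm : Measurable l) (hum : Measurable u)
    (hl0 : ∀ x, 0 ≤ l x) (hlu : ∀ x, l x ≤ u x) :
    (∀ x, 0 < p₀ x → 1 ≤ (p₀ x + u x) / (p₀ x + l x)) ∧
    2 * ∫⁻ x in {x | 0 < p₀ x}, ENNReal.ofReal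
        ((Real.exp (Real.log ((p₀ x + u x) / (p₀ x + l x))) - 1 -
            Real.log ((p₀ x + u x) / (p₀ x + l x))) * p₀ x) ∂μ ≤
      4 * ∫⁻ x, ENNReal.ofReal ((Real.sqrt (u x) - Real.sqrt (l x)) ^ 2) ∂μ := by
  refine ⟨fun x hx => (one_le_div (by linarith [hl0 x])).2 (by linarith [hlu x]), ?_⟩
  have key : ∫⁻ x in {x | 0 < p₀ x}, ENNReal.ofReal
        ((Real.exp (Real.log ((p₀ x + u x) / (p₀ x + l x))) - 1 -
            Real.log ((p₀ x + u x) / (p₀ x + l x))) * p₀ x) ∂μ ≤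
      2 * ∫⁻ x, ENNReal.ofReal ((Real.sqrt (u x) - Real.sqrt (l x)) ^ 2) ∂μ := by
    rw [← lintegral_const_mul' 2 _ (by norm_num)]
    refine le_trans (setLIntegral_mono' (measurableSet_lt measurable_const hp₀m) ?_)
      (setLIntegral_le_lintegral {x | 0 < p₀ x} _)
    intro x hx
    refine (ENNReal.ofReal_le_ofReal (pt_aux _ _ _ hx (hl0 x) (hlu x))).trans ?_
    rw [ENNReal.ofReal_mul (by norm_num)]
    simp
  calc _ ≤ 2 * (2 * ∫⁻ x, ENNReal.ofReal ((Real.sqrt (u x) - Real.sqrt (l x)) ^ 2) ∂μ) := by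
        gcongr
    _ = _ := by rw [← mul_assoc]; norm_num
end

section
/- Let (X, 𝒜, μ) be a σ-finite measure space, let p₀ and p_θ be probability densities with respect to μ, and let D_θ = p₀/(p₀+p_θ) (set to 1/2 where p₀+p_θ = 0). Let ℓ, u : X → (0,1] be measurable with ℓ ≤ u pointwise and ℓ > 0 everywhere. Then 2·∫ ( e^{log(u/ℓ)} − 1 − log(u/ℓ) ) p₀ dμ ≤ 4·∫ p₀ · (√(u/ℓ) − 1)² dμ = 4·∫ (D_θ/ℓ) · (√u − √ℓ)² (p₀+p_θ) dμ. -/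
open MeasureTheory
open scoped ENNReal

/-- Bracket-transfer bound for the cross-entropy objective: for measurable
`ℓ, u : X → (0,1]` with `ℓ ≤ u` and `ℓ > 0` everywhere,
`2∫(e^{log(u/ℓ)} − 1 − log(u/ℓ)) p₀ dμ ≤ 4∫ p₀ (√(u/ℓ)−1)² dμ
  = 4∫(D_θ/ℓ)(√u−√ℓ)²(p₀+p_θ) dμ`. -/
theorem stmt13 {X : Type*} [MeasurableSpace X] (μ : Measure X) [SigmaFinite μ]
    (p₀ pθ : X → ℝ) (hp₀m : Measurable p₀) (hpθm : Measurable pθ)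
    (hp₀0 : ∀ x, 0 ≤ p₀ x) (hpθ0 : ∀ x, 0 ≤ pθ x)
    (hp₀1 : ∫⁻ x, ENNReal.ofReal (p₀ x) ∂μ = 1)
    (hpθ1 : ∫⁻ x, ENNReal.ofReal (pθ x) ∂μ = 1)
    (l u : X → ℝ) (hlm : Measurable l) (hum : Measurable u)
    (hl0 : ∀ x, 0 < l x) (hlu : ∀ x, l x ≤ u x) (hu1 : ∀ x, u x ≤ 1) :
    2 * ∫⁻ x, ENNReal.ofReal
        ((Real.exp (Real.log (u x / l x)) - 1 - Real.log (u x / l x)) * p₀ x) ∂μ ≤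
      4 * ∫⁻ x, ENNReal.ofReal (p₀ x * (Real.sqrt (u x / l x) - 1) ^ 2) ∂μ ∧
    4 * ∫⁻ x, ENNReal.ofReal (p₀ x * (Real.sqrt (u x / l x) - 1) ^ 2) ∂μ =
      4 * ∫⁻ x, ENNReal.ofReal
        (oracleD p₀ pθ x / l x * (Real.sqrt (u x) - Real.sqrt (l x)) ^ 2 * (p₀ x + pθ x)) ∂μ := by
  have h2 : (2 : ℝ≥0∞) = ENNReal.ofReal 2 := by simp
  constructor
  · have h4 : (4 : ℝ≥0∞) = 2 * 2 := by norm_num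
    rw [h4, mul_assoc]
    gcongr 2 * ?_
    rw [← lintegral_const_mul' _ _ (by simp)]
    apply lintegral_mono
    intro x
    show ENNReal.ofReal _ ≤ 2 * ENNReal.ofReal _
    rw [h2, ← ENNReal.ofReal_mul (by norm_num)]
    apply ENNReal.ofReal_le_ofReal
    have h1 : 1 ≤ u x / l x := (one_le_div (hl0 x)).2 (hlu x)
    have hpos : 0 < u x / l x := by linarith
    have hs1 : 1 ≤ Real.sqrt (u x / l x) := Real.one_le_sqrt.2 h1
    have hsq : Real.sqrt (u x / l x) ^ 2 = u x / l x := Real.sq_sqrt hpos.le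
    rw [Real.exp_log hpos]
    generalize Real.sqrt (u x / l x) = s at *
    rw [← hsq, Real.log_pow]
    have hlog := Real.le_log_one_add_of_nonneg (sub_nonneg.2 hs1)
    have hq : (s - 1) * (3 - s) / 2 ≤ 2 * (s - 1) / (s - 1 + 2) := by
      rw [div_le_div_iff₀ (by norm_num) (by linarith)]
      nlinarith [mul_nonneg (sub_nonneg.2 hs1) (sq_nonneg (s - 1))]
    have e : 1 + (s - 1) = s := by ring
    rw [e] at hlog
    have hk : s ^ 2 - 1 - ((2 : ℕ) : ℝ) * Real.log s ≤ 2 * (s - 1) ^ 2 := by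
      push_cast
      nlinarith
    have := mul_le_mul_of_nonneg_right hk (hp₀0 x)
    linarith
  · congr 1
    apply lintegral_congr
    intro x
    congr 1
    have hl := hl0 x
    have hD : oracleD p₀ pθ x * (p₀ x + pθ x) = p₀ x := by
      unfold oracleD
      have ha := hp₀0 x
      have hb := hpθ0 x
      split_ifs with h
      · field_simp
      · have : p₀ x = 0 := by linarith
        have : pθ x = 0 := by linarith
        simp [*]
    have hu : Real.sqrt (u x / l x) = Real.sqrt (u x) / Real.sqrt (l x) :=
      Real.sqrt_div' _ hl.le
    have hsl : 0 < Real.sqrt (l x) := Real.sqrt_pos.2 hl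
    have hsq : Real.sqrt (l x) ^ 2 = l x := Real.sq_sqrt hl.le
    have hE : (Real.sqrt (u x / l x) - 1) ^ 2
        = (Real.sqrt (u x) - Real.sqrt (l x)) ^ 2 / l x := by
      rw [hu, div_sub_one hsl.ne', div_pow, hsq]
    rw [hE]
    nth_rewrite 1 [← hD]
    ring
end

section
/- For every real number x ≥ −log 2 (equivalently x ≥ log(1/2)), e^{|x|} − 1 − |x| ≤ 4·(e^{x/2} − 1)². -/
/-- For every real `x ≥ −log 2` (equivalently `x ≥ log(1/2)`),
`e^{|x|} − 1 − |x| ≤ 4(e^{x/2} − 1)²`. -/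
theorem stmt15 (x : ℝ) (hx : -Real.log 2 ≤ x) :
    Real.exp |x| - 1 - |x| ≤ 4 * (Real.exp (x / 2) - 1) ^ 2 := by
  have key : ∀ y : ℝ, 0 ≤ y → 1 ≤ Real.exp (y / 2) ∧
      4 * (Real.exp (y / 2) - 1) ≤ y * (Real.exp (y / 2) + 1) := by
    intro y hy
    have h1 : 1 ≤ Real.exp (y / 2) := Real.one_le_exp (by linarith)
    refine ⟨h1, ?_⟩
    have h := Real.le_log_one_add_of_nonneg (x := Real.exp (y / 2) - 1) (by linarith)
    rw [show 1 + (Real.exp (y / 2) - 1) = Real.exp (y / 2) by ring, Real.log_exp,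
      div_le_iff₀ (by linarith)] at h
    linarith
  have hsq : ∀ y : ℝ, Real.exp y = Real.exp (y / 2) ^ 2 := by
    intro y
    rw [← Real.exp_nat_mul]
    congr 1
    push_cast
    ring
  rcases le_total 0 x with h0 | h0
  · rw [abs_of_nonneg h0, hsq x]
    obtain ⟨h1, h2⟩ := key x h0
    generalize Real.exp (x / 2) = t at *
    -- (t - 1)(5 - 3t)(t + 1) ≤ 4 (t - 1)
    have h3 : (t - 1) * (5 - 3 * t) * (t + 1) ≤ x * (t + 1) := by
      nlinarith [mul_nonneg (sub_nonneg.2 h1) (mul_nonneg (sub_nonneg.2 h1)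
        (by linarith : (0:ℝ) ≤ 3 * t + 1))]
    have h4 := le_of_mul_le_mul_right h3 (by linarith)
    nlinarith
  · rw [abs_of_nonpos h0, hsq (-x)]
    obtain ⟨h1, h2⟩ := key (-x) (by linarith)
    have ht2 : Real.exp (-x / 2) ^ 2 ≤ 2 := by
      rw [← hsq, ← Real.le_log_iff_exp_le (by norm_num)]
      linarith
    have he : Real.exp (x / 2) = (Real.exp (-x / 2))⁻¹ := by
      rw [← Real.exp_neg]
      congr 1
      ring
    rw [he]
    generalize Real.exp (-x / 2) = t at *
    have ht : 0 < t := by linarith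
    have e : 4 * (t⁻¹ - 1) ^ 2 = 4 * (t - 1) ^ 2 / t ^ 2 := by
      field_simp
      ring
    have h5 : (t - 1) ^ 2 * (t + 3) / (t + 1) ≤ 4 * (t - 1) ^ 2 / t ^ 2 := by
      rw [div_le_div_iff₀ (by linarith) (by positivity)]
      have : (t + 3) * t ^ 2 ≤ 4 * (t + 1) := by nlinarith
      nlinarith [mul_le_mul_of_nonneg_left this (sq_nonneg (t - 1))]
    have h6 : t ^ 2 - 1 - -x ≤ (t - 1) ^ 2 * (t + 3) / (t + 1) := by
      rw [le_div_iff₀ (by linarith)]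
      nlinarith
    rw [e]
    exact h6.trans h5
end

section
/- For every real number x ≥ −1/2, e^{|x|} − 1 − |x| ≤ (e^{x} − 1)². -/
/-- For every real `x ≥ −1/2`, `e^{|x|} − 1 − |x| ≤ (e^x − 1)²`. -/
theorem stmt16 (x : ℝ) (hx : -(1 / 2 : ℝ) ≤ x) :
    Real.exp |x| - 1 - |x| ≤ (Real.exp x - 1) ^ 2 := by
  rcases le_total 0 x with h | h
  · rw [abs_of_nonneg h]
    have h1 := Real.add_one_le_exp x
    have h2 := Real.add_one_le_exp (-x)
    have h3 : Real.exp x * Real.exp (-x) = 1 := by rw [← Real.exp_add]; simp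
    have h4 : Real.exp x * (-x + 1) ≤ 1 := by
      exact (mul_le_mul_of_nonneg_left h2 (Real.exp_pos x).le).trans h3.le
    nlinarith [mul_nonneg (sub_nonneg.2 h1) h, mul_nonneg h h,
      mul_nonneg (sub_nonneg.2 h1) (sub_nonneg.2 h1)]
  · rw [abs_of_nonpos h]
    obtain ⟨y, rfl⟩ : ∃ y, x = -y := ⟨-x, by ring⟩
    have hy : 0 ≤ y := by linarith
    have hy2 : y ≤ 1 / 2 := by linarith
    rw [neg_neg]
    have b1 := Real.exp_bound (x := y) (by rw [abs_of_nonneg hy]; linarith) (n := 4) (by norm_num)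
    have b2 := Real.exp_bound (x := -y) (by rw [abs_neg, abs_of_nonneg hy]; linarith) (n := 4)
      (by norm_num)
    rw [abs_neg] at b2
    rw [abs_of_nonneg hy] at b1 b2
    replace b1 := (abs_le.1 b1).2
    replace b2 := (abs_le.1 b2).2
    norm_num [Finset.sum_range_succ, Nat.factorial] at b1 b2
    have y2 : 0 ≤ y ^ 2 := by positivity
    have y3 : 0 ≤ y ^ 3 := by positivity
    have e1 : y ^ 4 ≤ y ^ 3 / 2 := by nlinarith
    have e2 : y * (1 - y / 2 + 9 / 64 * y ^ 2) ≤ 1 - Real.exp (-y) := by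
      have : y ^ 3 * (1/2 - y) ≥ 0 := mul_nonneg y3 (by linarith)
      ring_nf at b2 this ⊢
      linarith
    have p0 : 0 ≤ 1 - y / 2 + 9 / 64 * y ^ 2 := by nlinarith
    have e3 := pow_le_pow_left₀ (mul_nonneg hy p0) e2 2
    have e4 : 1 / 2 + y / 6 + 5 / 96 * y ^ 2 ≤ (1 - y / 2 + 9 / 64 * y ^ 2) ^ 2 := by
      have f1 : y ^ 3 ≤ y ^ 2 / 2 := by nlinarith
      have f2 : 0 ≤ y ^ 4 := by positivity
      have f3 : y ^ 2 ≥ y - 1 / 4 := by nlinarith [sq_nonneg (y - 1 / 2)]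
      nlinarith
    have e5 := mul_le_mul_of_nonneg_left e4 y2
    calc Real.exp y - 1 - y ≤ y ^ 2 * (1 / 2 + y / 6 + 5 / 96 * y ^ 2) := by
          ring_nf at b1 ⊢
          linarith
      _ ≤ (y * (1 - y / 2 + 9 / 64 * y ^ 2)) ^ 2 := by rw [mul_pow]; exact e5
      _ ≤ (1 - Real.exp (-y)) ^ 2 := e3
      _ = _ := by ring
end

section
/- Fix an input dimension d ≥ 1, a depth L ≥ 1, and layer widths U₁, …, U_L ≥ 1. Let σ, Λ : ℝ → ℝ be Lipschitz with constant 1 and set σ₀ := |σ(0)|. A weight configuration w consists of a U₁×d matrix w₀, matrices w_ℓ of size U_{ℓ+1}×U_ℓ for 1 ≤ ℓ ≤ L−1, and a row vector w_L of length U_L, defining the network output f(x; w) := Λ( w_L σ( w_{L−1} σ( ⋯ w₁ σ( w₀ x ) ) ) ) with σ applied entrywise. Let w and w̃ be two weight configurations that have the same sparsity pattern (nonzero entries only in the same positions), such that every entry is at most C > 0 in absolute value and, for every ℓ ≥ 1, every row of w_ℓ (hence of w̃_ℓ) has at most Ũ ≥ 1 nonzero entries, with Ũ·C ≥ 2. Then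 for every x ∈ ℝ^d, |f(x; w) − f(x; w̃)| ≤ (L+1) · Ũ^{L+1} · C^{L} · d · ‖w − w̃‖_∞ · (σ₀ + ‖x‖_∞), where ‖w − w̃‖_∞ is the maximum absolute difference over all corresponding weight entries and ‖x‖_∞ is the maximum absolute coordinate of x. -/
/-- Layer outputs of a feedforward neural network: `layerOutput σ U w 0 x = x` (the input,
of dimension `U 0 = d`), and `layerOutput σ U w (ℓ+1) x = σ(w_ℓ · layerOutput σ U w ℓ x)`
with the activation `σ` applied entrywise. -/
def layerOutput (σ : ℝ → ℝ) (U : ℕ → ℕ)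
    (w : (ℓ : ℕ) → Matrix (Fin (U (ℓ + 1))) (Fin (U ℓ)) ℝ) :
    (ℓ : ℕ) → (Fin (U 0) → ℝ) → Fin (U ℓ) → ℝ
  | 0, x => x
  | ℓ + 1, x => fun i => σ (∑ j, w ℓ i j * layerOutput σ U w ℓ x j)

theorem aux_dot {n : ℕ} (a y : Fin n → ℝ) (s : Finset (Fin n)) (m : ℕ) (hs : s.card ≤ m)
    (ha : ∀ j ∉ s, a j = 0) (C B : ℝ) (hC : 0 ≤ C) (hB : 0 ≤ B)
    (haC : ∀ j, |a j| ≤ C) (hy : ∀ j, |y j| ≤ B) :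
    |∑ j, a j * y j| ≤ m * (C * B) := by
  have h1 : ∑ j, a j * y j = ∑ j ∈ s, a j * y j := by
    symm
    apply Finset.sum_subset (Finset.subset_univ s)
    intro j _ hj
    rw [ha j hj, zero_mul]
  rw [h1]
  calc |∑ j ∈ s, a j * y j| ≤ ∑ j ∈ s, |a j * y j| := Finset.abs_sum_le_sum_abs _ _
    _ ≤ ∑ _j ∈ s, C * B := by
        apply Finset.sum_le_sum
        intro j _
        rw [abs_mul]
        exact mul_le_mul (haC j) (hy j) (abs_nonneg _) hC
    _ = s.card * (C * B) := by simp
    _ ≤ m * (C * B) := by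
        have : (s.card : ℝ) ≤ m := by exact_mod_cast hs
        have := mul_nonneg hC hB
        gcongr

theorem aux_diff {n : ℕ} (a a' y y' : Fin n → ℝ) (s : Finset (Fin n)) (m : ℕ) (hs : s.card ≤ m)
    (ha : ∀ j ∉ s, a j = 0) (hp : ∀ j, a j = 0 ↔ a' j = 0) (C B M D : ℝ) (hC : 0 ≤ C) (hB : 0 ≤ B)
    (hM : 0 ≤ M) (hD : 0 ≤ D)
    (haC : ∀ j, |a' j| ≤ C) (haM : ∀ j, |a j - a' j| ≤ M) (hy : ∀ j, |y j| ≤ B)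
    (hyD : ∀ j, |y j - y' j| ≤ D) :
    |∑ j, a j * y j - ∑ j, a' j * y' j| ≤ m * (M * B) + m * (C * D) := by
  have h : ∑ j, a j * y j - ∑ j, a' j * y' j
      = ∑ j, (a j - a' j) * y j + ∑ j, a' j * (y j - y' j) := by
    rw [← Finset.sum_sub_distrib, ← Finset.sum_add_distrib]
    apply Finset.sum_congr rfl
    intro j _
    ring
  rw [h]
  refine (abs_add_le _ _).trans (add_le_add ?_ ?_)
  · exact aux_dot (fun j => a j - a' j) y s m hs
      (fun j hj => by simp [ha j hj, (hp j).1 (ha j hj)]) M B hM hB haM hy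
  · exact aux_dot a' (fun j => y j - y' j) s m hs
      (fun j hj => (hp j).1 (ha j hj)) C D hC hD haC hyD

theorem aux_lip (σ : ℝ → ℝ) (hσ : LipschitzWith 1 σ) (a b : ℝ) : |σ a - σ b| ≤ |a - b| := by
  have := hσ.dist_le_mul a b
  simpa [Real.dist_eq] using this

theorem aux_lip0 (σ : ℝ → ℝ) (hσ : LipschitzWith 1 σ) (a : ℝ) : |σ a| ≤ |σ 0| + |a| := by
  have h1 := aux_lip σ hσ a 0
  have h2 := abs_add_le (σ a - σ 0) (σ 0)
  simp only [sub_add_cancel, sub_zero] at h1 h2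
  linarith

/-- Lipschitz-in-weights estimate for a feedforward network
`f(x; w) = Λ(w_L σ(w_{L−1} σ(⋯ w₁ σ(w₀ x))))` with 1-Lipschitz `σ`, `Λ`: if the two
weight configurations `(w, wL)` and `(w', wL')` have the same sparsity pattern, entries
bounded by `C > 0`, at most `Ũ` nonzero entries per row in every layer after the input
layer (including the output vector), `Ũ·C ≥ 2`, and all corresponding entries differ by
at most `M` (so `M` can be taken to be `‖w − w'‖_∞`), then for every input `x`,
`|f(x;w) − f(x;w')| ≤ (L+1)·Ũ^{L+1}·C^L·d·M·(σ₀ + ‖x‖_∞)` with `σ₀ = |σ(0)|`, `d = U 0`. -/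
theorem stmt19 (σ Λ : ℝ → ℝ) (hσ : LipschitzWith 1 σ) (hΛ : LipschitzWith 1 Λ)
    (U : ℕ → ℕ) (L : ℕ) (hL : 1 ≤ L)
    (hd : 1 ≤ U 0) (hU : ∀ ℓ, ℓ < L → 1 ≤ U (ℓ + 1))
    (w w' : (ℓ : ℕ) → Matrix (Fin (U (ℓ + 1))) (Fin (U ℓ)) ℝ)
    (wL wL' : Fin (U L) → ℝ)
    (C : ℝ) (hC : 0 < C)
    (hw : ∀ ℓ, ℓ < L → ∀ i j, |w ℓ i j| ≤ C)
    (hw' : ∀ ℓ, ℓ < L → ∀ i j, |w' ℓ i j| ≤ C)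
    (hwL : ∀ j, |wL j| ≤ C) (hwL' : ∀ j, |wL' j| ≤ C)
    (hpattern : ∀ ℓ, ℓ < L → ∀ i j, w ℓ i j = 0 ↔ w' ℓ i j = 0)
    (hpatternL : ∀ j, wL j = 0 ↔ wL' j = 0)
    (Ut : ℕ) (hUt : 1 ≤ Ut)
    (hsparse : ∀ ℓ, 1 ≤ ℓ → ℓ < L → ∀ i, ∃ s : Finset (Fin (U ℓ)),
      s.card ≤ Ut ∧ ∀ j ∉ s, w ℓ i j = 0)
    (hsparseL : ∃ s : Finset (Fin (U L)), s.card ≤ Ut ∧ ∀ j ∉ s, wL j = 0)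
    (hUC : 2 ≤ (Ut : ℝ) * C)
    (M : ℝ)
    (hM : ∀ ℓ, ℓ < L → ∀ i j, |w ℓ i j - w' ℓ i j| ≤ M)
    (hML : ∀ j, |wL j - wL' j| ≤ M) :
    ∀ x : Fin (U 0) → ℝ,
      |Λ (∑ j, wL j * layerOutput σ U w L x j) -
          Λ (∑ j, wL' j * layerOutput σ U w' L x j)| ≤
        (L + 1 : ℝ) * (Ut : ℝ) ^ (L + 1) * C ^ L * (U 0 : ℝ) * M * (|σ 0| + ‖x‖) := by
  intro x
  have hM0 : 0 ≤ M := (abs_nonneg _).trans (hM 0 (by omega) ⟨0, hU 0 (by omega)⟩ ⟨0, hd⟩)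
  have hUt1 : (1 : ℝ) ≤ Ut := by exact_mod_cast hUt
  have hd1 : (1 : ℝ) ≤ U 0 := by exact_mod_cast hd
  have hX : 0 ≤ ‖x‖ := norm_nonneg x
  have hxj : ∀ j, |x j| ≤ ‖x‖ := fun j => norm_le_pi_norm x j
  have hs0 : 0 ≤ |σ 0| := abs_nonneg _
  have hCK : C ≤ Ut * C := by nlinarith
  have hcard : (Finset.univ : Finset (Fin (U 0))).card ≤ U 0 := by simp
  generalize hs : |σ 0| = s0 at *
  generalize hXx : ‖x‖ = X at *
  generalize hdd : (U 0 : ℝ) = d at *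
  -- size of layers
  have hB : ∀ ℓ, ℓ < L → ∀ j, |layerOutput σ U w (ℓ + 1) x j| ≤
      (((Ut : ℝ) * C) ^ (ℓ + 1) - 1) * s0 + ((Ut : ℝ) * C) ^ (ℓ + 1) * (d * X) := by
    intro ℓ
    induction ℓ with
    | zero =>
      intro hl i
      have h1 := aux_dot (w 0 i) x Finset.univ (U 0) hcard (by simp) C X hC.le hX (hw 0 hl i) hxj
      have h2 := aux_lip0 σ hσ (∑ j, w 0 i j * x j)
      rw [hs] at h2
      rw [hdd] at h1
      have h3 : |layerOutput σ U w (0 + 1) x i| ≤ s0 + d * (C * X) := h2.trans (by linarith)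
      have h4 : C * (d * X) ≤ Ut * C * (d * X) :=
        mul_le_mul_of_nonneg_right hCK (by positivity)
      simp only [zero_add, pow_one] at h3 ⊢
      nlinarith
    | succ ℓ ih =>
      intro hl i
      obtain ⟨s, hsc, hsz⟩ := hsparse (ℓ + 1) (by omega) hl i
      have hP : (1 : ℝ) ≤ ((Ut : ℝ) * C) ^ (ℓ + 1) := one_le_pow₀ (by linarith)
      have hnn : 0 ≤ (((Ut : ℝ) * C) ^ (ℓ + 1) - 1) * s0 + ((Ut : ℝ) * C) ^ (ℓ + 1) * (d * X) := by
        have : 0 ≤ ((Ut : ℝ) * C) ^ (ℓ + 1) - 1 := by linarith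
        positivity
      have h1 := aux_dot (w (ℓ + 1) i) _ s Ut hsc hsz C _ hC.le hnn (hw _ hl i) (ih (by omega))
      have h2 := aux_lip0 σ hσ (∑ j, w (ℓ + 1) i j * layerOutput σ U w (ℓ + 1) x j)
      rw [hs] at h2
      refine (h2.trans (add_le_add_right h1 _)).trans ?_
      rw [pow_succ _ (ℓ + 1)]
      nlinarith
  have hB' : ∀ ℓ, ℓ < L → ∀ j, |layerOutput σ U w (ℓ + 1) x j| ≤
      ((Ut : ℝ) * C) ^ (ℓ + 1) * (d * (s0 + X)) := by
    intro ℓ hl j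
    refine (hB ℓ hl j).trans ?_
    have hP : (0 : ℝ) ≤ ((Ut : ℝ) * C) ^ (ℓ + 1) := by positivity
    have h5 : ((Ut : ℝ) * C) ^ (ℓ + 1) * s0 ≤ ((Ut : ℝ) * C) ^ (ℓ + 1) * (d * s0) :=
      mul_le_mul_of_nonneg_left (by nlinarith) hP
    nlinarith
  have hD : ∀ ℓ, ℓ < L → ∀ j,
      |layerOutput σ U w (ℓ + 1) x j - layerOutput σ U w' (ℓ + 1) x j| ≤
      ((ℓ : ℝ) + 1) * (Ut : ℝ) ^ (ℓ + 1) * C ^ ℓ * d * M * (s0 + X) := by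
    intro ℓ
    induction ℓ with
    | zero =>
      intro hl i
      have h1 := aux_diff (w 0 i) (w' 0 i) x x Finset.univ (U 0) hcard (by simp)
        (hpattern 0 hl i) C X M 0 hC.le hX hM0 le_rfl (hw' 0 hl i) (hM 0 hl i) hxj (by simp)
      rw [hdd] at h1
      refine (aux_lip σ hσ _ _).trans (h1.trans ?_)
      have h2 : 0 ≤ d * M * s0 := by positivity
      have h3 : 0 ≤ d * M * (s0 + X) := by positivity
      have h4 : d * M * (s0 + X) ≤ Ut * (d * M * (s0 + X)) := by nlinarith
      simp
      nlinarith
    | succ ℓ ih =>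
      intro hl i
      obtain ⟨s, hsc, hsz⟩ := hsparse (ℓ + 1) (by omega) hl i
      have h1 := aux_diff (w (ℓ + 1) i) (w' (ℓ + 1) i) _ _ s Ut hsc hsz
        (hpattern _ hl i) C _ M _ hC.le (by positivity) hM0 (by positivity) (hw' _ hl i)
        (hM _ hl i) (hB' ℓ (by omega)) (ih (by omega))
      refine (aux_lip σ hσ _ _).trans (h1.trans (le_of_eq ?_))
      push_cast
      rw [mul_pow]
      ring
  obtain ⟨K, rfl⟩ : ∃ K, L = K + 1 := ⟨L - 1, by omega⟩
  obtain ⟨s, hsc, hsz⟩ := hsparseL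
  have h1 := aux_diff wL wL' _ _ s Ut hsc hsz
    hpatternL C _ M _ hC.le (by positivity) hM0 (by positivity) hwL'
    hML (hB' K (by omega)) (hD K (by omega))
  refine (aux_lip Λ hΛ _ _).trans (h1.trans (le_of_eq ?_))
  push_cast
  rw [mul_pow]
  ring
end
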